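/- arXiv:2201.08107 — 10 statements merged into one kernel-verified Lean document; each statement's English description precedes it below -/
import Mathlib

section
/- Fix a real number μ and let b < a < 0 be real numbers with −1 < μ < −4a³/27 − 1 (so that for each α ∈ {a, b} the equation f(v,α) = μ has three real roots v₁^μ(α) < v₂^μ(α) < v₃^μ(α)). Then v₁^μ(b) < v₁^μ(a), v₂^μ(b) > v₂^μ(a), and v₃^μ(b) < v₃^μ(a); that is, as α decreases, the smallest root strictly decreases, the middle root strictly increases, and the largest root strictly decreases. -/
/-- Vieta's formulas for three distinct roots of the cubic `v³ - c v² - 1 = μ`. -/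
lemma vieta_of_cubic_roots {μ c x y z : ℝ} (hxy : x < y) (hyz : y < z)
    (hx : x ^ 3 - c * x ^ 2 - 1 = μ) (hy : y ^ 3 - c * y ^ 2 - 1 = μ)
    (hz : z ^ 3 - c * z ^ 2 - 1 = μ) :
    x + y + z = c ∧ x * y + y * z + z * x = 0 ∧ x * y * z = μ + 1 := by
  have h₁ : x ^ 2 + x * y + y ^ 2 - c * (x + y) = 0 :=
    mul_left_cancel₀ (sub_ne_zero.2 hxy.ne') (by linear_combination hy - hx)
  have h₂ : y ^ 2 + y * z + z ^ 2 - c * (y + z) = 0 :=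
    mul_left_cancel₀ (sub_ne_zero.2 hyz.ne') (by linear_combination hz - hy)
  have hsum : x + y + z - c = 0 :=
    mul_left_cancel₀ (sub_ne_zero.2 (hxy.trans hyz).ne') (by linear_combination h₂ - h₁)
  have hpair : x * y + y * z + z * x = 0 := by
    linear_combination (x + y) * hsum - h₁
  refine ⟨by linarith, hpair, ?_⟩
  linear_combination hx + x * hpair - x ^ 2 * hsum

/-- Three ordered reals with vanishing second elementary symmetric function and positive product
have signs `-`, `-`, `+`. -/
lemma signs_of_pair_sum_eq_zero {x y z : ℝ} (hxy : x < y) (hyz : y < z)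
    (hpair : x * y + y * z + z * x = 0) (hprod : 0 < x * y * z) : y < 0 ∧ 0 < z := by
  have hx : x < 0 := by
    by_contra! hx
    nlinarith [mul_nonneg hx (hx.trans hxy.le), mul_pos (hx.trans_lt hxy)
      ((hx.trans_lt hxy).trans hyz), mul_nonneg ((hx.trans hxy.le).trans hyz.le) hx]
  have hneg : y * z < 0 := by
    by_contra! h
    nlinarith [mul_nonneg (neg_nonneg.2 hx.le) h]
  rcases mul_neg_iff.1 hneg with h | h
  · linarith [h.1, h.2]
  · exact h

/-- A point below `r` where `(x - p) (x - q) (x - r)` is positive lies between `p` and `q`. -/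
lemma mem_Ioo_of_cubic_pos {p q r x : ℝ} (hpq : p < q) (hxr : x < r)
    (h : 0 < (x - p) * (x - q) * (x - r)) : p < x ∧ x < q := by
  have hneg : (x - p) * (x - q) < 0 := by
    by_contra! h'
    nlinarith [mul_nonneg h' (sub_nonneg.2 hxr.le)]
  rcases mul_neg_iff.1 hneg with h' | h' <;> constructor <;> linarith [h'.1, h'.2]

/-- Fix `μ` and let `b < a < 0` with `-1 < μ < -4a³/27 - 1`.  If `v₁a < v₂a < v₃a` are the
three real roots of `v³ - a v² - 1 = μ` and `v₁b < v₂b < v₃b` those of `v³ - b v² - 1 = μ`,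
then `v₁b < v₁a`, `v₂b > v₂a` and `v₃b < v₃a`. -/
theorem roots_monotone_in_alpha (μ a b : ℝ) (hba : b < a) (ha : a < 0)
    (hμ₁ : -1 < μ) (hμ₂ : μ < -4 * a ^ 3 / 27 - 1)
    (v₁a v₂a v₃a v₁b v₂b v₃b : ℝ)
    (ha₁ : v₁a < v₂a) (ha₂ : v₂a < v₃a)
    (hrootsa : ∀ v : ℝ, v ^ 3 - a * v ^ 2 - 1 = μ ↔ v = v₁a ∨ v = v₂a ∨ v = v₃a)
    (hb₁ : v₁b < v₂b) (hb₂ : v₂b < v₃b)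
    (hrootsb : ∀ v : ℝ, v ^ 3 - b * v ^ 2 - 1 = μ ↔ v = v₁b ∨ v = v₂b ∨ v = v₃b) :
    v₁b < v₁a ∧ v₂a < v₂b ∧ v₃b < v₃a := by
  obtain ⟨hsa, hea, hpa⟩ := vieta_of_cubic_roots ha₁ ha₂ ((hrootsa _).2 (.inl rfl))
    ((hrootsa _).2 (.inr (.inl rfl))) ((hrootsa _).2 (.inr (.inr rfl)))
  obtain ⟨hsb, heb, hpb⟩ := vieta_of_cubic_roots hb₁ hb₂ ((hrootsb _).2 (.inl rfl))
    ((hrootsb _).2 (.inr (.inl rfl))) ((hrootsb _).2 (.inr (.inr rfl)))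
  obtain ⟨ha₂neg, ha₃pos⟩ := signs_of_pair_sum_eq_zero ha₁ ha₂ hea (by linarith)
  obtain ⟨hb₂neg, hb₃pos⟩ := signs_of_pair_sum_eq_zero hb₁ hb₂ heb (by linarith)
  have key : ∀ x : ℝ, x ≠ 0 → x ^ 3 - a * x ^ 2 - 1 = μ →
      0 < (x - v₁b) * (x - v₂b) * (x - v₃b) := by
    intro x hx hroot
    have hfactor : (x - v₁b) * (x - v₂b) * (x - v₃b) = (a - b) * x ^ 2 := by
      linear_combination hroot - x ^ 2 * hsb + x * heb - hpb
    rw [hfactor]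
    exact mul_pos (sub_pos.2 hba) (by positivity)
  refine ⟨(mem_Ioo_of_cubic_pos hb₁ (by linarith)
      (key v₁a (by linarith : v₁a < 0).ne ((hrootsa _).2 (.inl rfl)))).1,
    (mem_Ioo_of_cubic_pos hb₁ (by linarith)
      (key v₂a ha₂neg.ne ((hrootsa _).2 (.inr (.inl rfl))))).2, ?_⟩
  have hmul : 0 < (v₃a - v₁b) * (v₃a - v₂b) :=
    mul_pos (by linarith) (by linarith)
  exact sub_pos.1 ((mul_pos_iff_of_pos_left hmul).1
    (key v₃a ha₃pos.ne' ((hrootsa _).2 (.inr (.inr rfl)))))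
end

section
/- Let α be a real number and set f(v) = v³ − αv² − 1. Let a < b be real numbers with b < +∞, and let φ : (a,b) → ℝ be a differentiable function such that for all v ∈ (a,b): φ(v) > 0, v·f(v) + φ(v)² > 0, and φ′(v) = φ(v)·f(v) / (v·f(v) + φ(v)²). Then the one-sided limit of φ(v) as v → b⁻ exists and is finite. -/
open Filter Topology

/-- A real function that is continuous on an open interval and has no zero there has constant
sign. -/
theorem pos_or_neg_of_ne_zero_on_Ioo {f : ℝ → ℝ} {c b : ℝ} (hf : ContinuousOn f (Set.Ioo c b))
    (h : ∀ v ∈ Set.Ioo c b, f v ≠ 0) :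
    (∀ v ∈ Set.Ioo c b, 0 < f v) ∨ (∀ v ∈ Set.Ioo c b, f v < 0) := by
  by_contra! hcon
  obtain ⟨⟨x, hx, hfx⟩, y, hy, hfy⟩ := hcon
  obtain ⟨z, hz, hfz⟩ := isPreconnected_Ioo.intermediate_value hx hy hf ⟨hfx, hfy⟩
  exact h z hz hfz

/-- To the left of any point, the cubic `v³ - αv² - 1` has constant sign near that point. -/
theorem exists_Ioo_cubic_pos_or_neg (α : ℝ) {a b : ℝ} (hab : a < b) :
    ∃ c ∈ Set.Ico a b, (∀ v ∈ Set.Ioo c b, 0 < v ^ 3 - α * v ^ 2 - 1) ∨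
      (∀ v ∈ Set.Ioo c b, v ^ 3 - α * v ^ 2 - 1 < 0) := by
  let p : Polynomial ℝ := .X ^ 3 - .C α * .X ^ 2 - 1
  have hp : p ≠ 0 := by
    intro h
    simpa [p] using congrArg (Polynomial.eval 0) h
  have hroots : {v : ℝ | p.IsRoot v}.Finite := Polynomial.finite_setOfPred_isRoot hp
  have hmem : {v : ℝ | v ^ 3 - α * v ^ 2 - 1 ≠ 0} ∈ 𝓝[<] b := by
    have h : ({v : ℝ | p.IsRoot v} \ {b})ᶜ ∈ 𝓝 b :=
      (hroots.subset Set.sdiff_subset).isClosed.isOpen_compl.mem_nhds (by simp)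
    filter_upwards [mem_nhdsWithin_of_mem_nhds h, self_mem_nhdsWithin] with v hv hvb hzero
    exact hv ⟨by simpa [p] using hzero, ne_of_lt hvb⟩
  obtain ⟨c, hc, hsub⟩ := (mem_nhdsLT_iff_exists_mem_Ico_Ioo_subset hab).1 hmem
  exact ⟨c, hc, pos_or_neg_of_ne_zero_on_Ioo (by fun_prop) fun v hv => hsub hv⟩

/-- An increasing solution of `dz/dv = z f(v)/(v f(v) + z²)`, with `f` continuous, is
bounded on a bounded interval. -/
theorem bddAbove_of_monotoneOn {f φ : ℝ → ℝ} {c b : ℝ} (hf : Continuous f)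
    (hmono : MonotoneOn φ (Set.Ioo c b))
    (hode : ∀ v ∈ Set.Ioo c b, HasDerivAt φ (φ v * f v / (v * f v + φ v ^ 2)) v) :
    BddAbove (φ '' Set.Ioo c b) := by
  obtain ⟨F, hF⟩ := (isCompact_Icc (a := c) (b := b)).exists_bound_of_continuousOn hf.continuousOn
  obtain ⟨M, hM⟩ := (isCompact_Icc (a := c) (b := b)).exists_bound_of_continuousOn
    (f := fun v => v * f v) (by fun_prop)
  simp only [Real.norm_eq_abs] at hF hM
  by_cases hlarge : ∃ w ∈ Set.Ioo c b, 1 + 2 * |M| < φ w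
  · obtain ⟨w, hw, hφw⟩ := hlarge
    have hF0 : 0 ≤ F := (abs_nonneg _).trans (hF w (Set.Ioo_subset_Icc_self hw))
    have hwsub : Set.Ico w b ⊆ Set.Ioo c b := fun v hv => ⟨hw.1.trans_le hv.1, hv.2⟩
    have hderiv : ∀ v ∈ Set.Ico w b, φ v * f v / (v * f v + φ v ^ 2) ≤ 2 * F := by
      intro v hv
      have hvI := hwsub hv
      have h1 := abs_le.1 (hF v (Set.Ioo_subset_Icc_self hvI))
      have h2 := abs_le.1 (hM v (Set.Ioo_subset_Icc_self hvI))
      have h3 : 1 + 2 * |M| < φ v := hφw.trans_le (hmono hw hvI hv.1)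
      have hM0 := abs_nonneg M
      have hMle := le_abs_self M
      have h4 : φ v ≤ 2 * (v * f v + φ v ^ 2) := by nlinarith [h2.1]
      rw [div_le_iff₀ (by linarith)]
      nlinarith [h1.2]
    refine ⟨φ w + 2 * F * (b - c), ?_⟩
    rintro _ ⟨v, hv, rfl⟩
    rcases le_total v w with hvw | hwv
    · have h1 := hmono hv hw hvw
      nlinarith [hv.1, hv.2]
    · have h := (convex_Ico w b).image_sub_le_mul_sub_of_deriv_le
        (fun x hx => (hode x (hwsub hx)).continuousAt.continuousWithinAt)
        (fun x hx => (hode x (hwsub (interior_subset hx))).differentiableAt.differentiableWithinAt)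
        (C := 2 * F) (fun x hx => by
          rw [(hode x (hwsub (interior_subset hx))).deriv]
          exact hderiv x (interior_subset hx))
        w ⟨le_rfl, hw.2⟩ v ⟨hwv, hv.2⟩ hwv
      nlinarith [hv.2, hw.1]
  · push Not at hlarge
    exact ⟨1 + 2 * |M|, by rintro _ ⟨v, hv, rfl⟩; exact hlarge v hv⟩


/-- Let `f(v) = v³ - αv² - 1` and let `φ : (a,b) → ℝ` (with `b < +∞`) be a differentiable
solution of `dz/dv = z f(v)/(v f(v) + z²)` with `φ > 0` and `v f(v) + φ(v)² > 0` on `(a,b)`.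
Then the one-sided limit of `φ(v)` as `v → b⁻` exists and is finite. -/
theorem solution_has_finite_left_limit (α a b : ℝ) (hab : a < b) (φ : ℝ → ℝ)
    (hpos : ∀ v ∈ Set.Ioo a b, 0 < φ v)
    (hden : ∀ v ∈ Set.Ioo a b, 0 < v * (v ^ 3 - α * v ^ 2 - 1) + (φ v) ^ 2)
    (hode : ∀ v ∈ Set.Ioo a b,
      HasDerivAt φ
        (φ v * (v ^ 3 - α * v ^ 2 - 1) / (v * (v ^ 3 - α * v ^ 2 - 1) + (φ v) ^ 2)) v) :
    ∃ L : ℝ, Tendsto φ (𝓝[Set.Ioo a b] b) (𝓝 L) := by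
  obtain ⟨c, ⟨hac, hcb⟩, hsign⟩ := exists_Ioo_cubic_pos_or_neg α hab
  have hsub : Set.Ioo c b ⊆ Set.Ioo a b := Set.Ioo_subset_Ioo_left hac
  have hne : (Set.Ioo c b).Nonempty := Set.nonempty_Ioo.2 hcb
  have hcont : ContinuousOn φ (Set.Ioo c b) := fun v hv =>
    (hode v (hsub hv)).continuousAt.continuousWithinAt
  have hdiff : DifferentiableOn ℝ φ (interior (Set.Ioo c b)) := fun v hv =>
    (hode v (hsub (interior_subset hv))).differentiableAt.differentiableWithinAt
  rw [nhdsWithin_Ioo_eq_nhdsLT hab]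
  rcases hsign with h | h
  · have hmono : MonotoneOn φ (Set.Ioo c b) := by
      refine monotoneOn_of_deriv_nonneg (convex_Ioo c b) hcont hdiff fun v hv => ?_
      have hv' := interior_subset hv
      rw [(hode v (hsub hv')).deriv]
      exact div_nonneg (mul_nonneg (hpos v (hsub hv')).le (h v hv').le) (hden v (hsub hv')).le
    have hbdd : BddAbove (φ '' Set.Ioo c b) :=
      bddAbove_of_monotoneOn (f := fun v => v ^ 3 - α * v ^ 2 - 1) (by fun_prop) hmono
        fun v hv => hode v (hsub hv)
    exact ⟨_, hmono.tendsto_nhdsWithin_Ioo_left hne hbdd⟩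
  · have hanti : AntitoneOn φ (Set.Ioo c b) := by
      refine antitoneOn_of_deriv_nonpos (convex_Ioo c b) hcont hdiff fun v hv => ?_
      have hv' := interior_subset hv
      rw [(hode v (hsub hv')).deriv]
      exact div_nonpos_of_nonpos_of_nonneg
        (mul_nonpos_of_nonneg_of_nonpos (hpos v (hsub hv')).le (h v hv').le) (hden v (hsub hv')).le
    have hbdd : BddBelow (φ '' Set.Ioo c b) :=
      ⟨0, by rintro _ ⟨v, hv, rfl⟩; exact (hpos v (hsub hv)).le⟩
    exact ⟨_, hanti.tendsto_nhdsWithin_Ioo_left hne hbdd⟩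
end

section
/- (Comparison theorem, first boundary condition.) Let x₀ < x₁ be real numbers, let ξ and η be continuously differentiable real-valued functions on (x₀, x₁), and let g be a continuous real-valued function on a set D ⊆ ℝ² containing the graphs {(x, ξ(x)) : x₀ < x < x₁} and {(x, η(x)) : x₀ < x < x₁}. Assume that ξ′(x) − g(x, ξ(x)) < η′(x) − g(x, η(x)) for all x ∈ (x₀, x₁), and that limsup_{x→x₀⁺} (ξ(x) − η(x)) < 0. Then ξ(x) < η(x) for all x ∈ (x₀, x₁). -/
open Filter Topology

/-- Comparison theorem, first boundary condition.  If `ξ, η` are `C¹` on `(x₀,x₁)`, `g` is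
continuous on a set `D` containing both graphs, `ξ' - g(x,ξ) < η' - g(x,η)` on `(x₀,x₁)` and
`limsup_{x→x₀⁺} (ξ - η) < 0`, then `ξ < η` on `(x₀,x₁)`. -/
theorem comparison_first_boundary (x₀ x₁ : ℝ) (hx : x₀ < x₁)
    (ξ η ξ' η' : ℝ → ℝ) (D : Set (ℝ × ℝ)) (g : ℝ × ℝ → ℝ)
    (hg : ContinuousOn g D)
    (hξD : ∀ x ∈ Set.Ioo x₀ x₁, (x, ξ x) ∈ D)
    (hηD : ∀ x ∈ Set.Ioo x₀ x₁, (x, η x) ∈ D)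
    (hξ : ∀ x ∈ Set.Ioo x₀ x₁, HasDerivAt ξ (ξ' x) x)
    (hη : ∀ x ∈ Set.Ioo x₀ x₁, HasDerivAt η (η' x) x)
    (hξ'c : ContinuousOn ξ' (Set.Ioo x₀ x₁))
    (hη'c : ContinuousOn η' (Set.Ioo x₀ x₁))
    (hcomp : ∀ x ∈ Set.Ioo x₀ x₁, ξ' x - g (x, ξ x) < η' x - g (x, η x))
    (hlim : Filter.limsup (fun x => ((ξ x - η x : ℝ) : EReal)) (𝓝[Set.Ioo x₀ x₁] x₀)
      < (0 : EReal)) :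
    ∀ x ∈ Set.Ioo x₀ x₁, ξ x < η x := by
  have hneg : ∀ᶠ x in 𝓝[Set.Ioo x₀ x₁] x₀, ξ x < η x := by
    filter_upwards [Filter.eventually_lt_of_limsup_lt hlim] with x h
    exact sub_neg.1 (by exact_mod_cast h)
  rw [nhdsWithin_Ioo_eq_nhdsGT hx] at hneg
  have hderiv : ∀ x ∈ Set.Ioo x₀ x₁, ξ x = η x → ξ' x < η' x := fun x hxI h => by
    have := hcomp x hxI
    rw [h] at this
    linarith
  have hle : ∀ x ∈ Set.Ioo x₀ x₁, ξ x ≤ η x := fun x hxI => by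
    obtain ⟨a, hab, ha⟩ := (hneg.and (Ioo_mem_nhdsGT hxI.1)).exists
    have hsub : Set.Icc a x ⊆ Set.Ioo x₀ x₁ := Set.Icc_subset_Ioo ha.1 hxI.2
    exact image_le_of_deriv_right_lt_deriv_boundary'
      (fun y hy => (hξ y (hsub hy)).continuousAt.continuousWithinAt)
      (fun y hy => (hξ y (hsub (Set.Ico_subset_Icc_self hy))).hasDerivWithinAt) hab.le
      (fun y hy => (hη y (hsub hy)).continuousAt.continuousWithinAt)
      (fun y hy => (hη y (hsub (Set.Ico_subset_Icc_self hy))).hasDerivWithinAt)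
      (fun y hy => hderiv y (hsub (Set.Ico_subset_Icc_self hy)))
      (Set.right_mem_Icc.2 ha.2.le)
  intro x hxI
  refine (hle x hxI).lt_of_ne fun heq => ?_
  have hmax : IsLocalMax (ξ - η) x := by
    filter_upwards [Ioo_mem_nhds hxI.1 hxI.2] with y hy
    simpa [heq] using hle y hy
  have hzero := hmax.hasDerivAt_eq_zero ((hξ x hxI).sub (hη x hxI))
  linarith [hderiv x hxI heq]
end

section
/- (Comparison theorem, second boundary condition.) Let x₀ < x₁ be real numbers, let ξ and η be continuously differentiable real-valued functions on (x₀, x₁), and let g be a continuous real-valued function on a set D ⊆ ℝ² containing the graphs {(x, ξ(x)) : x₀ < x < x₁} and {(x, η(x)) : x₀ < x < x₁}. Assume that ξ′(x) − g(x, ξ(x)) < η′(x) − g(x, η(x)) for all x ∈ (x₀, x₁), that limsup_{x→x₀⁺} (ξ(x) − η(x)) = 0, and that limsup_{x→x₀⁺} (ξ′(x) − η′(x)) < 0. Then ξ(x) < η(x) for all x ∈ (x₀, x₁). -/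
open Filter Topology

/-- A function with strictly negative derivative at `c` exceeds `f c` just to the left of `c`. -/
theorem HasDerivAt.eventually_lt_left_of_neg {f : ℝ → ℝ} {f' c : ℝ} (hf : HasDerivAt f f' c)
    (hf' : f' < 0) : ∀ᶠ z in 𝓝[<] c, f c < f z := by
  have hslope := (hasDerivAt_iff_tendsto_slope_left_right.1 hf).1
  filter_upwards [hslope.eventually_lt_const hf', self_mem_nhdsWithin] with z hz hzc
  have hzc' : z - c < 0 := sub_neg.2 hzc
  rw [slope_def_field, div_neg_iff] at hz
  rcases hz with ⟨h, -⟩ | ⟨-, h⟩ <;> linarith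

/-- A function that is negative at the left endpoint of a closed interval and has negative derivative at
each of its zeros is negative on the whole interval. -/
theorem neg_of_hasDerivAt_neg_of_eq_zero {a b : ℝ} {f f' : ℝ → ℝ}
    (hf : ∀ x ∈ Set.Icc a b, HasDerivAt f (f' x) x) (ha : f a < 0)
    (hzero : ∀ x ∈ Set.Icc a b, f x = 0 → f' x < 0) :
    ∀ x ∈ Set.Icc a b, f x < 0 := by
  intro x hx
  by_contra! hfx
  have hcont : ContinuousOn f (Set.Icc a b) := fun y hy => (hf y hy).continuousAt.continuousWithinAt
  obtain ⟨c, ⟨hcI, hfc⟩, hmin⟩ := (isCompact_Icc.of_isClosed_subset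
    (hcont.preimage_isClosed_of_isClosed isClosed_Icc isClosed_Ici)
    Set.inter_subset_left).exists_isLeast ⟨x, hx, hfx⟩
  rw [Set.mem_preimage, Set.mem_Ici] at hfc
  have hac : a < c := hcI.1.lt_of_ne (by rintro rfl; linarith)
  have hleft : ∀ᶠ z in 𝓝[<] c, f z < 0 := by
    filter_upwards [Ioo_mem_nhdsLT hac] with z hz
    by_contra! h
    exact (hmin ⟨⟨hz.1.le, hz.2.le.trans hcI.2⟩, h⟩).not_gt hz.2
  have hfc0 : f c = 0 := le_antisymm
    (le_of_tendsto ((hf c hcI).continuousAt.tendsto.mono_left nhdsWithin_le_nhds)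
      (hleft.mono fun _ h => h.le)) hfc
  obtain ⟨z, hz, hz'⟩ :=
    (((hf c hcI).eventually_lt_left_of_neg (hzero c hcI hfc0)).and hleft).exists
  linarith

/-- A strictly decreasing function whose upper limit at the left end of an open interval is
nonpositive is negative on that interval. -/
theorem StrictAntiOn.neg_of_limsup_nonpos {a b : ℝ} {f : ℝ → ℝ}
    (hf : StrictAntiOn f (Set.Ioo a b))
    (hlim : limsup (fun x => (f x : EReal)) (𝓝[>] a) ≤ 0) :
    ∀ x ∈ Set.Ioo a b, f x < 0 := by
  intro x hx
  obtain ⟨y, hay, hyx⟩ := exists_between hx.1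
  have hy : y ∈ Set.Ioo a b := ⟨hay, hyx.trans hx.2⟩
  have hle : (f y : EReal) ≤ limsup (fun x => (f x : EReal)) (𝓝[>] a) := by
    refine le_limsup_of_frequently_le (Eventually.frequently ?_)
    filter_upwards [Ioo_mem_nhdsGT hay] with z hz
    exact EReal.coe_le_coe_iff.2 (hf ⟨hz.1, hz.2.trans hy.2⟩ hy hz.2).le
  exact (hf hy hx hyx).trans_le (EReal.coe_nonpos.1 (hle.trans hlim))

/-- Comparison theorem, second boundary condition.  If `ξ, η` are `C¹` on `(x₀,x₁)`, `g` is
continuous on a set `D` containing both graphs, `ξ' - g(x,ξ) < η' - g(x,η)` on `(x₀,x₁)`,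
`limsup_{x→x₀⁺} (ξ - η) = 0` and `limsup_{x→x₀⁺} (ξ' - η') < 0`, then `ξ < η` on `(x₀,x₁)`. -/
theorem comparison_second_boundary (x₀ x₁ : ℝ) (hx : x₀ < x₁)
    (ξ η ξ' η' : ℝ → ℝ) (D : Set (ℝ × ℝ)) (g : ℝ × ℝ → ℝ)
    (hg : ContinuousOn g D)
    (hξD : ∀ x ∈ Set.Ioo x₀ x₁, (x, ξ x) ∈ D)
    (hηD : ∀ x ∈ Set.Ioo x₀ x₁, (x, η x) ∈ D)
    (hξ : ∀ x ∈ Set.Ioo x₀ x₁, HasDerivAt ξ (ξ' x) x)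
    (hη : ∀ x ∈ Set.Ioo x₀ x₁, HasDerivAt η (η' x) x)
    (hξ'c : ContinuousOn ξ' (Set.Ioo x₀ x₁))
    (hη'c : ContinuousOn η' (Set.Ioo x₀ x₁))
    (hcomp : ∀ x ∈ Set.Ioo x₀ x₁, ξ' x - g (x, ξ x) < η' x - g (x, η x))
    (hlim₁ : Filter.limsup (fun x => ((ξ x - η x : ℝ) : EReal)) (𝓝[Set.Ioo x₀ x₁] x₀)
      = (0 : EReal))
    (hlim₂ : Filter.limsup (fun x => ((ξ' x - η' x : ℝ) : EReal)) (𝓝[Set.Ioo x₀ x₁] x₀)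
      < (0 : EReal)) :
    ∀ x ∈ Set.Ioo x₀ x₁, ξ x < η x := by
  have hd : ∀ x ∈ Set.Ioo x₀ x₁, HasDerivAt (fun t => ξ t - η t) (ξ' x - η' x) x :=
    fun x hx => (hξ x hx).sub (hη x hx)
  rw [nhdsWithin_Ioo_eq_nhdsGT hx] at hlim₁ hlim₂
  obtain ⟨b, hb, hb'⟩ := (mem_nhdsGT_iff_exists_Ioo_subset' hx).1
    (inter_mem (eventually_lt_of_limsup_lt hlim₂) (Ioo_mem_nhdsGT hx))
  have hanti : StrictAntiOn (fun t => ξ t - η t) (Set.Ioo x₀ b) := by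
    refine strictAntiOn_of_deriv_neg (convex_Ioo x₀ b)
      (fun t ht => (hd t (hb' ht).2).continuousAt.continuousWithinAt) fun t ht => ?_
    rw [interior_Ioo] at ht
    rw [(hd t (hb' ht).2).deriv]
    exact EReal.coe_neg'.1 (hb' ht).1
  have hneg := hanti.neg_of_limsup_nonpos hlim₁.le
  intro x hxI
  obtain ⟨a, hx₀a, ha⟩ := exists_between (lt_min hb hxI.1)
  obtain ⟨hab, hax⟩ := lt_min_iff.1 ha
  have hsub : ∀ t ∈ Set.Icc a x, t ∈ Set.Ioo x₀ x₁ :=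
    fun t ht => ⟨hx₀a.trans_le ht.1, ht.2.trans_lt hxI.2⟩
  refine sub_neg.1 (neg_of_hasDerivAt_neg_of_eq_zero (fun t ht => hd t (hsub t ht))
    (hneg a ⟨hx₀a, hab⟩) (fun t ht h0 => ?_) x ⟨hax.le, le_rfl⟩)
  have h := hcomp t (hsub t ht)
  rw [sub_eq_zero.1 h0] at h
  linarith
end

section
/- Let b < a < −3·4^{−1/3} be real numbers, and for α ∈ {a,b} let v₁⁰(α) denote the smallest real root of f(v,α) = 0. Suppose φ_a : (v₁⁰(a), 0) → ℝ and φ_b : (v₁⁰(b), 0) → ℝ are differentiable functions with, for each α ∈ {a,b} and all v in the respective domain: φ_α(v) > 0, v·f(v,α) + φ_α(v)² > 0, φ_α′(v) = φ_α(v)·f(v,α)/(v·f(v,α) + φ_α(v)²), and φ_α(v) → 0 as v → v₁⁰(α)⁺. Then φ_a(v) < φ_b(v) for all v ∈ (v₁⁰(a), 0). -/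
open Filter Topology

/-- If `f < g` near the left end, and `f` crosses `g` only with a smaller slope, then `f < g`. -/
theorem lt_of_deriv_lt_of_eq {f g f' g' : ℝ → ℝ} {l r : ℝ}
    (hf : ∀ x ∈ Set.Ioo l r, HasDerivAt f (f' x) x)
    (hg : ∀ x ∈ Set.Ioo l r, HasDerivAt g (g' x) x)
    (hcross : ∀ x ∈ Set.Ioo l r, f x = g x → f' x < g' x)
    (hstart : ∀ᶠ x in 𝓝[Set.Ioo l r] l, f x < g x) :
    ∀ x ∈ Set.Ioo l r, f x < g x := by
  have hle : ∀ x ∈ Set.Ioo l r, f x ≤ g x := by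
    intro x hx
    have hlr : l < r := hx.1.trans hx.2
    rw [nhdsWithin_Ioo_eq_nhdsGT hlr] at hstart
    obtain ⟨c, hfg, hc⟩ := (hstart.and (Ioo_mem_nhdsGT hx.1)).exists
    have hsub : ∀ y ∈ Set.Icc c x, y ∈ Set.Ioo l r := fun y hy =>
      ⟨hc.1.trans_le hy.1, hy.2.trans_lt hx.2⟩
    exact image_le_of_deriv_right_lt_deriv_boundary'
      (fun y hy => (hf y (hsub y hy)).continuousAt.continuousWithinAt)
      (fun y hy => (hf y (hsub y (Set.Ico_subset_Icc_self hy))).hasDerivWithinAt)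
      hfg.le
      (fun y hy => (hg y (hsub y hy)).continuousAt.continuousWithinAt)
      (fun y hy => (hg y (hsub y (Set.Ico_subset_Icc_self hy))).hasDerivWithinAt)
      (fun y hy => hcross y (hsub y (Set.Ico_subset_Icc_self hy)))
      (Set.right_mem_Icc.2 hc.2.le)
  intro x hx
  refine (hle x hx).lt_of_ne fun heq => ?_
  have hmin : IsLocalMin (g - f) x := by
    filter_upwards [Ioo_mem_nhds hx.1 hx.2] with y hy
    have := hle y hy
    simp only [Pi.sub_apply]
    linarith
  have hzero := hmin.hasDerivAt_eq_zero ((hg x hx).sub (hf x hx))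
  have := hcross x hx heq
  linarith

/-- The slope `z p / (v p + z²)` is strictly increasing in `p` where the denominator is positive. -/
theorem slope_lt_slope {v z p q : ℝ} (hz : 0 < z) (hp : 0 < v * p + z ^ 2)
    (hq : 0 < v * q + z ^ 2) (hpq : p < q) :
    z * p / (v * p + z ^ 2) < z * q / (v * q + z ^ 2) := by
  rw [div_lt_div_iff₀ hp hq]
  nlinarith [mul_pos (pow_pos hz 3) (sub_pos.2 hpq)]

/-- The smallest root of `v³ - α v² - 1` strictly increases with `α`, as long as it is negative. -/
theorem smallest_root_lt {a b u w : ℝ} (hba : b < a) (hu0 : u < 0)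
    (hu : u ^ 3 - a * u ^ 2 - 1 = 0)
    (hw : ∀ v : ℝ, v ^ 3 - b * v ^ 2 - 1 = 0 → w ≤ v) : w < u := by
  have hsq : 0 < u ^ 2 := sq_pos_of_neg hu0
  have hau : a < u := by
    by_contra! h
    nlinarith [mul_nonneg hsq.le (sub_nonneg.2 h)]
  have hcont : ContinuousOn (fun v : ℝ => v ^ 3 - b * v ^ 2 - 1) (Set.Icc (b - 1) u) := by
    fun_prop
  obtain ⟨x, hx, hx0⟩ := intermediate_value_Ioo (by linarith) hcont
    (show (0 : ℝ) ∈ Set.Ioo _ _ from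
      ⟨by nlinarith [sq_nonneg (b - 1)], by nlinarith [mul_pos hsq (sub_pos.2 hba)]⟩)
  exact (hw x hx0).trans_lt hx.2

/-- Monotonicity of the unstable separatrix with respect to `α`.  For `b < a < -3·4^(-1/3)`,
with `v₁a, v₁b` the smallest roots of `f(·,a) = 0`, `f(·,b) = 0`, and `φa, φb` the corresponding
separatrix solutions of `dz/dv = z f/(v f + z²)` emanating from `(v₁(α),0)`, one has
`φa(v) < φb(v)` on `(v₁a, 0)`. -/
theorem separatrix_minus_monotone (a b : ℝ) (hba : b < a)
    (ha : a < -3 * (4 : ℝ) ^ (-(1 : ℝ) / 3))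
    (v₁a v₁b : ℝ)
    (hv₁a : v₁a ^ 3 - a * v₁a ^ 2 - 1 = 0 ∧ ∀ v : ℝ, v ^ 3 - a * v ^ 2 - 1 = 0 → v₁a ≤ v)
    (hv₁b : v₁b ^ 3 - b * v₁b ^ 2 - 1 = 0 ∧ ∀ v : ℝ, v ^ 3 - b * v ^ 2 - 1 = 0 → v₁b ≤ v)
    (φa φb : ℝ → ℝ)
    (hpa : ∀ v ∈ Set.Ioo v₁a (0 : ℝ), 0 < φa v ∧
      0 < v * (v ^ 3 - a * v ^ 2 - 1) + (φa v) ^ 2 ∧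
      HasDerivAt φa
        (φa v * (v ^ 3 - a * v ^ 2 - 1) / (v * (v ^ 3 - a * v ^ 2 - 1) + (φa v) ^ 2)) v)
    (hpb : ∀ v ∈ Set.Ioo v₁b (0 : ℝ), 0 < φb v ∧
      0 < v * (v ^ 3 - b * v ^ 2 - 1) + (φb v) ^ 2 ∧
      HasDerivAt φb
        (φb v * (v ^ 3 - b * v ^ 2 - 1) / (v * (v ^ 3 - b * v ^ 2 - 1) + (φb v) ^ 2)) v)
    (hla : Tendsto φa (𝓝[Set.Ioo v₁a (0 : ℝ)] v₁a) (𝓝 0))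
    (hlb : Tendsto φb (𝓝[Set.Ioo v₁b (0 : ℝ)] v₁b) (𝓝 0)) :
    ∀ v ∈ Set.Ioo v₁a (0 : ℝ), φa v < φb v := by
  intro v hv
  have hv₁a0 : v₁a < 0 := hv.1.trans hv.2
  have hroots : v₁b < v₁a := smallest_root_lt hba hv₁a0 hv₁a.1 hv₁b.2
  have hpb' : ∀ x ∈ Set.Ioo v₁a (0 : ℝ), x ∈ Set.Ioo v₁b (0 : ℝ) := fun x hx =>
    ⟨hroots.trans hx.1, hx.2⟩
  have hb₁ := hpb v₁a ⟨hroots, hv₁a0⟩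
  refine lt_of_deriv_lt_of_eq (fun x hx => (hpa x hx).2.2)
    (fun x hx => (hpb x (hpb' x hx)).2.2) ?_
    (hla.eventually_lt (hb₁.2.2.continuousAt.tendsto.mono_left nhdsWithin_le_nhds) hb₁.1) v hv
  intro x hx heq
  obtain ⟨hpos, hda, -⟩ := hpa x hx
  have hdb := (hpb x (hpb' x hx)).2.1
  rw [← heq] at hdb ⊢
  have hsq : 0 < x ^ 2 := sq_pos_of_neg hx.2
  exact slope_lt_slope hpos hda hdb (by nlinarith [mul_pos hsq (sub_pos.2 hba)])
end

section
/- Let b < a < −3·4^{−1/3} be real numbers, and for α ∈ {a,b} let v₃⁰(α) denote the largest real root of f(v,α) = 0 (so that v₃⁰(b) < v₃⁰(a)). Suppose φ_a : (0, v₃⁰(a)) → ℝ and φ_b : (0, v₃⁰(b)) → ℝ are differentiable functions with, for each α ∈ {a,b} and all v in the respective domain: φ_α(v) > 0, v·f(v,α) + φ_α(v)² > 0, φ_α′(v) = φ_α(v)·f(v,α)/(v·f(v,α) + φ_α(v)²), and φ_α(v) → 0 as v → v₃⁰(α)⁻. Then φ_a(v) > φ_b(v) for all v ∈ (0, v₃⁰(b)).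 -/
open Filter Topology

/-- Monotonicity of the stable separatrix with respect to `α`.  For `b < a < -3·4^(-1/3)`,
with `v₃a, v₃b` the largest roots of `f(·,a) = 0`, `f(·,b) = 0` (so `v₃b < v₃a`), and
`φa, φb` the corresponding separatrix solutions of `dz/dv = z f/(v f + z²)` tending to `0` at
`v₃(α)⁻`, one has `φa(v) > φb(v)` on `(0, v₃b)`. -/
theorem separatrix_plus_monotone (a b : ℝ) (hba : b < a)
    (ha : a < -3 * (4 : ℝ) ^ (-(1 : ℝ) / 3))
    (v₃a v₃b : ℝ)
    (hv₃a : v₃a ^ 3 - a * v₃a ^ 2 - 1 = 0 ∧ ∀ v : ℝ, v ^ 3 - a * v ^ 2 - 1 = 0 → v ≤ v₃a)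
    (hv₃b : v₃b ^ 3 - b * v₃b ^ 2 - 1 = 0 ∧ ∀ v : ℝ, v ^ 3 - b * v ^ 2 - 1 = 0 → v ≤ v₃b)
    (hv₃ : v₃b < v₃a)
    (φa φb : ℝ → ℝ)
    (hpa : ∀ v ∈ Set.Ioo (0 : ℝ) v₃a, 0 < φa v ∧
      0 < v * (v ^ 3 - a * v ^ 2 - 1) + (φa v) ^ 2 ∧
      HasDerivAt φa
        (φa v * (v ^ 3 - a * v ^ 2 - 1) / (v * (v ^ 3 - a * v ^ 2 - 1) + (φa v) ^ 2)) v)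
    (hpb : ∀ v ∈ Set.Ioo (0 : ℝ) v₃b, 0 < φb v ∧
      0 < v * (v ^ 3 - b * v ^ 2 - 1) + (φb v) ^ 2 ∧
      HasDerivAt φb
        (φb v * (v ^ 3 - b * v ^ 2 - 1) / (v * (v ^ 3 - b * v ^ 2 - 1) + (φb v) ^ 2)) v)
    (hla : Tendsto φa (𝓝[Set.Ioo (0 : ℝ) v₃a] v₃a) (𝓝 0))
    (hlb : Tendsto φb (𝓝[Set.Ioo (0 : ℝ) v₃b] v₃b) (𝓝 0)) :
    ∀ v ∈ Set.Ioo (0 : ℝ) v₃b, φb v < φa v := by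
  intro v hv
  by_contra! hle
  have hsub : ∀ x ∈ Set.Ioo (0 : ℝ) v₃b, x ∈ Set.Ioo (0 : ℝ) v₃a :=
    fun x hx => ⟨hx.1, hx.2.trans hv₃⟩
  have hb0 : 0 < v₃b := hv.1.trans hv.2
  -- Near `v₃b`, `φb` tends to `0` while `φa` stays positive.
  obtain ⟨w, hvw, hwb, hw⟩ : ∃ w, v < w ∧ w < v₃b ∧ φb w < φa w := by
    obtain ⟨hpos, -, hd⟩ := hpa v₃b ⟨hb0, hv₃⟩
    have hlim : Tendsto φb (𝓝[<] v₃b) (𝓝 0) := by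
      rwa [nhdsWithin_Ioo_eq_nhdsLT hb0] at hlb
    have hev := hlim.eventually_lt (hd.continuousAt.tendsto.mono_left nhdsWithin_le_nhds) hpos
    obtain ⟨w, hw, hvw, hwb⟩ := (hev.and (Ioo_mem_nhdsLT hv.2)).exists
    exact ⟨w, hvw, hwb, hw⟩
  have hmem : ∀ x ∈ Set.Icc v w, x ∈ Set.Ioo (0 : ℝ) v₃b :=
    fun x hx => ⟨hv.1.trans_le hx.1, hx.2.trans_lt hwb⟩
  -- Wherever the two graphs meet, `φa` has the smaller slope, so `φa ≤ φb` persists up to `w`.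
  refine hw.not_ge (image_le_of_deriv_right_lt_deriv_boundary'
    (fun x hx => (hpa x (hsub x (hmem x hx))).2.2.continuousAt.continuousWithinAt)
    (fun x hx => (hpa x (hsub x (hmem x ⟨hx.1, hx.2.le⟩))).2.2.hasDerivWithinAt) hle
    (fun x hx => (hpb x (hmem x hx)).2.2.continuousAt.continuousWithinAt)
    (fun x hx => (hpb x (hmem x ⟨hx.1, hx.2.le⟩)).2.2.hasDerivWithinAt) ?_
    (Set.right_mem_Icc.2 hvw.le))
  intro x hx heq
  have hxb := hmem x ⟨hx.1, hx.2.le⟩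
  obtain ⟨hz, hda, -⟩ := hpa x (hsub x hxb)
  obtain ⟨-, hdb, -⟩ := hpb x hxb
  rw [← heq] at hdb ⊢
  rw [div_lt_div_iff₀ hda hdb]
  have hgap : 0 < φa x ^ 3 * ((a - b) * x ^ 2) :=
    mul_pos (pow_pos hz 3) (mul_pos (sub_pos.2 hba) (pow_pos hxb.1 2))
  linarith
end

section
/- Let α < −3·4^{−1/3} and 0 < μ < −4α³/27 − 1. Let v₁^μ < v₂^μ denote the two smallest real roots of f(v,α) = μ, let v₂⁰ denote the middle real root of f(v,α) = 0, and set s = √μ·(√(−v₁^μ) + √(v₂^μ − v₁^μ)). Suppose φ : (v₁⁰(α), 0] → ℝ is continuous, differentiable on (v₁⁰(α),0), and satisfies on (v₁⁰(α), 0): φ(v) > 0, v·f(v,α) + φ(v)² > 0, φ′(v) = φ(v)·f(v,α)/(v·f(v,α) + φ(v)²), with φ(v) → 0 as v → v₁⁰(α)⁺. Then φ(0) ≥ s + v₂⁰/s. -/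
open Filter Topology

/-- Along a positive solution of `dz/dv = z f / (v f + z²)`, the quantity `z - c v / z` does not
decrease on an interval where `c ≤ f`. -/
lemma sub_mul_div_le_of_le_slope {f φ : ℝ → ℝ} {a b c : ℝ} (hab : a ≤ b)
    (hφ : ∀ v ∈ Set.Icc a b, 0 < φ v ∧ 0 < v * f v + φ v ^ 2 ∧
      HasDerivAt φ (φ v * f v / (v * f v + φ v ^ 2)) v)
    (hf : ∀ v ∈ Set.Icc a b, c ≤ f v) :
    φ a - c * (a / φ a) ≤ φ b - c * (b / φ b) := by
  have hder : ∀ v ∈ Set.Icc a b, HasDerivAt (fun v => φ v - c * (v / φ v))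
      ((f v - c) * φ v / (v * f v + φ v ^ 2)) v := by
    intro v hv
    obtain ⟨hpos, hden, hd⟩ := hφ v hv
    have h := hd.sub (((hasDerivAt_id v).div hd hpos.ne').const_mul c)
    refine h.congr_deriv ?_
    have hne := hpos.ne'
    obtain ⟨D, hD⟩ : ∃ D, D = v * f v + φ v ^ 2 := ⟨_, rfl⟩
    rw [← hD] at hden ⊢
    have hDne := hden.ne'
    simp only [id]
    field_simp
    linear_combination (-c) * hD
  have hmono : MonotoneOn (fun v => φ v - c * (v / φ v)) (Set.Icc a b) := by
    refine monotoneOn_of_deriv_nonneg (convex_Icc a b)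
      (fun v hv => (hder v hv).continuousAt.continuousWithinAt)
      (fun v hv => (hder v (interior_subset hv)).differentiableAt.differentiableWithinAt) ?_
    intro v hv
    have hv' := interior_subset hv
    rw [(hder v hv').deriv]
    obtain ⟨hpos, hden, -⟩ := hφ v hv'
    exact div_nonneg (mul_nonneg (sub_nonneg.2 (hf v hv')) hpos.le) hden.le
  exact hmono (Set.left_mem_Icc.2 hab) (Set.right_mem_Icc.2 hab) hab

/-- A cubic `v³ - α v² - k` with `0 < k` and three distinct real roots splits over them, and
exactly its largest root is positive. -/
lemma cubic_factor_of_three_roots {α k a b c : ℝ} (hk : 0 < k) (hab : a < b) (hbc : b < c)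
    (ha : a ^ 3 - α * a ^ 2 - k = 0) (hb : b ^ 3 - α * b ^ 2 - k = 0)
    (hc : c ^ 3 - α * c ^ 2 - k = 0) :
    (∀ v : ℝ, v ^ 3 - α * v ^ 2 - k = (v - a) * (v - b) * (v - c)) ∧ b < 0 ∧ 0 < c := by
  have h₁ : a ^ 2 + a * b + b ^ 2 - α * (a + b) = 0 := by
    refine (mul_eq_zero.1 (?_ : (b - a) * _ = 0)).resolve_left (sub_pos.2 hab).ne'
    linear_combination hb - ha
  have h₂ : b ^ 2 + b * c + c ^ 2 - α * (b + c) = 0 := by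
    refine (mul_eq_zero.1 (?_ : (c - b) * _ = 0)).resolve_left (sub_pos.2 hbc).ne'
    linear_combination hc - hb
  have hsum : a + b + c - α = 0 := by
    refine (mul_eq_zero.1 (?_ : (c - a) * _ = 0)).resolve_left (by linarith)
    linear_combination h₂ - h₁
  have hpair : a * b + a * c + b * c = 0 := by
    linear_combination (a + b) * hsum - h₁
  have hprod : a * b * c = k := by
    linear_combination ha - a ^ 2 * hsum + a * hpair
  have hc0 : 0 < c := by
    by_contra! h
    nlinarith [mul_nonneg_of_nonpos_of_nonpos (by linarith : a ≤ 0) (by linarith : b ≤ 0)]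
  refine ⟨fun v => ?_, ?_, hc0⟩
  · linear_combination v ^ 2 * hsum - v * hpair + hprod
  · by_contra! h
    have hab0 : 0 < a * b := by
      by_contra! h'
      nlinarith
    have ha0 : 0 < a := pos_of_mul_pos_left hab0 h
    nlinarith [mul_pos ha0 hc0, mul_nonneg h hc0.le]

/-- A positive `z` with `p ^ 2 - q ^ 2 < z ^ 2` and `2 p ≤ z + (p ^ 2 - q ^ 2) / z` is at least
the root `p + q` of `X ^ 2 - 2 p X + p ^ 2 - q ^ 2`. -/
lemma add_le_of_two_mul_le {p q z : ℝ} (hz : 0 < z)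
    (hsq : p ^ 2 - q ^ 2 < z ^ 2) (h : 2 * p ≤ z + (p ^ 2 - q ^ 2) / z) : p + q ≤ z := by
  have hquad : 0 ≤ (z - p - q) * (z - p + q) := by
    have := mul_le_mul_of_nonneg_right h hz.le
    rw [add_mul, div_mul_cancel₀ _ hz.ne'] at this
    linarith
  by_contra! hlt
  have : z - p + q ≤ 0 := by
    by_contra! h'
    nlinarith
  nlinarith

/-- Lower bound on the value at `0` of the unstable separatrix.  Let `α < -3·4^(-1/3)`,
`0 < μ < -4α³/27 - 1`, let `v₁μ < v₂μ < v₃μ` be the roots of `f(v,α) = μ` and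
`v₁ < v₂ < v₃` those of `f(v,α) = 0`, and set `s = √μ(√(-v₁μ) + √(v₂μ - v₁μ))`.  If
`φ : (v₁,0] → ℝ` is continuous, solves `dz/dv = z f/(v f + z²)` on `(v₁,0)` with `φ > 0`,
`v f + φ² > 0`, and `φ → 0` at `v₁⁺`, then `φ(0) ≥ s + v₂/s`. -/
theorem separatrix_minus_lower_bound (α μ : ℝ)
    (hα : α < -3 * (4 : ℝ) ^ (-(1 : ℝ) / 3))
    (hμ₀ : 0 < μ) (hμ₁ : μ < -4 * α ^ 3 / 27 - 1)
    (v₁μ v₂μ v₃μ v₁ v₂ v₃ : ℝ)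
    (hμo₁ : v₁μ < v₂μ) (hμo₂ : v₂μ < v₃μ)
    (hμroots : ∀ v : ℝ, v ^ 3 - α * v ^ 2 - 1 = μ ↔ v = v₁μ ∨ v = v₂μ ∨ v = v₃μ)
    (h0o₁ : v₁ < v₂) (h0o₂ : v₂ < v₃)
    (h0roots : ∀ v : ℝ, v ^ 3 - α * v ^ 2 - 1 = 0 ↔ v = v₁ ∨ v = v₂ ∨ v = v₃)
    (φ : ℝ → ℝ)
    (hcont : ContinuousOn φ (Set.Ioc v₁ (0 : ℝ)))
    (hp : ∀ v ∈ Set.Ioo v₁ (0 : ℝ), 0 < φ v ∧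
      0 < v * (v ^ 3 - α * v ^ 2 - 1) + (φ v) ^ 2 ∧
      HasDerivAt φ
        (φ v * (v ^ 3 - α * v ^ 2 - 1) / (v * (v ^ 3 - α * v ^ 2 - 1) + (φ v) ^ 2)) v)
    (hlim : Tendsto φ (𝓝[Set.Ioo v₁ (0 : ℝ)] v₁) (𝓝 0)) :
    Real.sqrt μ * (Real.sqrt (-v₁μ) + Real.sqrt (v₂μ - v₁μ)) +
        v₂ / (Real.sqrt μ * (Real.sqrt (-v₁μ) + Real.sqrt (v₂μ - v₁μ))) ≤ φ 0 := by
  obtain ⟨hfac, hv₂, hv₃⟩ := cubic_factor_of_three_roots one_pos h0o₁ h0o₂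
    ((h0roots v₁).2 (by simp)) ((h0roots v₂).2 (by simp)) ((h0roots v₃).2 (by simp))
  have hμfac' := cubic_factor_of_three_roots (α := α) (k := 1 + μ) (by linarith) hμo₁ hμo₂
    (by linarith [(hμroots v₁μ).2 (by simp)]) (by linarith [(hμroots v₂μ).2 (by simp)])
    (by linarith [(hμroots v₃μ).2 (by simp)])
  obtain ⟨hμfac, hv₂μ, hv₃μ⟩ := hμfac'
  have hbetween : ∀ v < 0, v ^ 3 - α * v ^ 2 - 1 = μ → v₁ < v ∧ v < v₂ := by
    intro v hv h
    have hneg : (v - v₁) * (v - v₂) < 0 := by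
      rw [hfac v] at h
      by_contra! h'
      nlinarith [mul_nonneg h' (by linarith : 0 ≤ v₃ - v)]
    constructor
    · by_contra! h'
      nlinarith
    · by_contra! h'
      nlinarith
  obtain ⟨ha₁, -⟩ := hbetween v₁μ (hμo₁.trans hv₂μ) ((hμroots v₁μ).2 (by simp))
  obtain ⟨-, hb₂⟩ := hbetween v₂μ hv₂μ ((hμroots v₂μ).2 (by simp))
  have hmem : ∀ {a b : ℝ}, v₁ < a → b < 0 → ∀ v ∈ Set.Icc a b, v ∈ Set.Ioo v₁ (0 : ℝ) :=
    fun ha hb v hv => ⟨ha.trans_le hv.1, hv.2.trans_lt hb⟩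
  have hstep : ∀ {a b c : ℝ}, v₁ < a → a ≤ b → b < 0 →
      (∀ v ∈ Set.Icc a b, c ≤ v ^ 3 - α * v ^ 2 - 1) →
      φ a - c * (a / φ a) ≤ φ b - c * (b / φ b) := fun ha hab hb hf =>
    sub_mul_div_le_of_le_slope hab (fun v hv => hp v (hmem ha hb v hv)) hf
  obtain ⟨hz₁, -, -⟩ := hp v₁μ ⟨ha₁, by linarith⟩
  obtain ⟨hz₂, hD₂, -⟩ := hp v₂μ ⟨by linarith, hv₂μ⟩
  obtain ⟨hz₃, -, -⟩ := hp v₂ ⟨h0o₁, hv₂⟩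
  rw [(hμroots v₂μ).2 (by simp)] at hD₂
  have hrise := hstep (c := μ) ha₁ hμo₁.le hv₂μ (fun v hv => by
    have := hμfac v
    have h₀ : 0 ≤ (v - v₁μ) * (v₂μ - v) * (v₃μ - v) :=
      mul_nonneg (mul_nonneg (by linarith [hv.1]) (by linarith [hv.2])) (by linarith [hv.2])
    linarith)
  have hflat := hstep (c := 0) (by linarith) hb₂.le hv₂ (fun v hv => by
    rw [hfac v]
    have h₀ : 0 ≤ (v - v₁) * (v₂ - v) * (v₃ - v) :=
      mul_nonneg (mul_nonneg (by linarith [hv.1]) (by linarith [hv.2])) (by linarith [hv.2])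
    linarith)
  simp only [zero_mul, sub_zero] at hflat
  have hfall : ∀ b, v₂ ≤ b → b < 0 → φ v₂ + v₂ / φ v₂ ≤ φ b := by
    intro b hb hb0
    have h := hstep (c := -1) h0o₁ hb hb0 (fun v hv => by
      have hα₂ : α < v₂ := by
        have h₂ := (h0roots v₂).2 (by simp)
        by_contra! h'
        nlinarith [mul_nonneg (sq_nonneg v₂) (sub_nonneg.2 h')]
      nlinarith [mul_nonneg (sq_nonneg v) (by linarith [hv.1] : 0 ≤ v - α)])
    have hpos := (hp b ⟨by linarith, hb0⟩).1
    have := div_neg_of_neg_of_pos hb0 hpos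
    linarith
  have hφ0 : φ v₂ + v₂ / φ v₂ ≤ φ 0 := by
    have ht : Tendsto φ (𝓝[<] 0) (𝓝 (φ 0)) :=
      (hcont 0 ⟨by linarith, le_rfl⟩).mono_of_mem_nhdsWithin
        (mem_of_superset (Ioo_mem_nhdsLT (h0o₁.trans hv₂)) Set.Ioo_subset_Ioc_self)
    refine ge_of_tendsto ht ?_
    filter_upwards [Ioo_mem_nhdsLT hv₂] with b hb using hfall b hb.1.le hb.2
  set p := √μ * √(-v₁μ) with hpdef
  set q := √μ * √(v₂μ - v₁μ) with hqdef
  have hp2 : p ^ 2 = -(μ * v₁μ) := by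
    rw [hpdef, mul_pow, Real.sq_sqrt hμ₀.le, Real.sq_sqrt (by linarith)]
    ring
  have hq2 : q ^ 2 = μ * (v₂μ - v₁μ) := by
    rw [hqdef, mul_pow, Real.sq_sqrt hμ₀.le, Real.sq_sqrt (by linarith)]
  have hppos : 0 < p := mul_pos (Real.sqrt_pos.2 hμ₀) (Real.sqrt_pos.2 (by linarith))
  have hqpos : 0 < q := mul_pos (Real.sqrt_pos.2 hμ₀) (Real.sqrt_pos.2 (by linarith))
  have hamgm : 2 * p ≤ φ v₁μ - μ * (v₁μ / φ v₁μ) := by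
    have h : φ v₁μ - μ * (v₁μ / φ v₁μ) - 2 * p = (φ v₁μ - p) ^ 2 / φ v₁μ := by
      field_simp
      linear_combination -hp2
    have := div_nonneg (sq_nonneg (φ v₁μ - p)) hz₁.le
    linarith
  have hdiff : p ^ 2 - q ^ 2 = -(μ * v₂μ) := by
    rw [hp2, hq2]
    ring
  have hs : p + q ≤ φ v₂μ := by
    refine add_le_of_two_mul_le hz₂ (by linarith) (hamgm.trans (hrise.trans_eq ?_))
    rw [hdiff]
    ring
  have hspos : 0 < p + q := add_pos hppos hqpos
  have hle : p + q ≤ φ v₂ := hs.trans hflat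
  have hdiv : v₂ / (p + q) ≤ v₂ / φ v₂ := by
    rw [div_le_div_iff₀ hspos hz₃]
    exact mul_le_mul_of_nonpos_left hle hv₂.le
  rw [mul_add]
  linarith
end

section
/- Let α < −3·4^{−1/3} and −1 < λ < 0. Let v₃⁰ denote the largest real root of f(v,α) = 0, let v₃^λ denote the largest real root of f(v,α) = λ (so 0 < v₃^λ < v₃⁰), and set z₃ = √(−λ)·(√(v₃⁰) + √(v₃⁰ − v₃^λ)). Suppose φ : (0, v₃⁰) → ℝ is differentiable and satisfies on (0, v₃⁰): φ(v) > 0, v·f(v,α) + φ(v)² > 0, φ′(v) = φ(v)·f(v,α)/(v·f(v,α) + φ(v)²), with φ(v) → 0 as v → v₃⁰⁻. Then limsup_{v→0⁺} φ(v) ≤ z₃ + v₃^λ/z₃. -/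
open Filter Topology

/-- `z / m + v / z`, a first integral of `dz/dv = -m z / (z² - m v)`, is nondecreasing along
solutions of `dz/dv = z F / (v F + z²)` as long as `-m ≤ F`. -/
theorem div_add_div_le_of_hasDerivAt {F φ : ℝ → ℝ} {a b m : ℝ} (hm : 0 < m) (hab : a ≤ b)
    (hF : ∀ v ∈ Set.Icc a b, -m ≤ F v)
    (hp : ∀ v ∈ Set.Icc a b, 0 < φ v ∧ 0 < v * F v + φ v ^ 2 ∧
      HasDerivAt φ (φ v * F v / (v * F v + φ v ^ 2)) v) :
    φ a / m + a / φ a ≤ φ b / m + b / φ b := by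
  have hd : ∀ v ∈ Set.Icc a b, HasDerivAt (fun v => φ v / m + v / φ v)
      (φ v * (1 + F v / m) / (v * F v + φ v ^ 2)) v := by
    intro v hv
    obtain ⟨h0, hD, h⟩ := hp v hv
    refine ((h.div_const m).fun_add ((hasDerivAt_id' v).fun_div h h0.ne')).congr_deriv ?_
    generalize hDe : v * F v + φ v ^ 2 = D at hD
    field_simp
    rw [← hDe]
    ring
  have hmono : MonotoneOn (fun v => φ v / m + v / φ v) (Set.Icc a b) := by
    refine monotoneOn_of_deriv_nonneg (convex_Icc a b)
      (fun v hv => (hd v hv).continuousAt.continuousWithinAt)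
      (fun v hv => (hd v (interior_subset hv)).differentiableAt.differentiableWithinAt) ?_
    intro v hv
    have hv' := interior_subset hv
    rw [(hd v hv').deriv]
    obtain ⟨h0, hD, -⟩ := hp v hv'
    have h1 : 0 ≤ 1 + F v / m := by
      have : -1 ≤ F v / m := by
        rw [le_div_iff₀ hm]
        linarith [hF v hv']
      linarith
    positivity
  exact hmono (Set.left_mem_Icc.2 hab) (Set.right_mem_Icc.2 hab) hab

/-- If a solution of `dz/dv = z F / (v F + z²)` with `-m ≤ F` passes from above to below the
parabola `z² = m v` between `a` and `b`, then `z / m + v / z` at `a` is at most `2 √(b / m)`. -/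
theorem div_add_div_le_of_crosses_parabola {F φ : ℝ → ℝ} {a b m : ℝ} (hm : 0 < m)
    (hab : a ≤ b) (hF : ∀ v ∈ Set.Icc a b, -m ≤ F v)
    (hp : ∀ v ∈ Set.Icc a b, 0 < φ v ∧ 0 < v * F v + φ v ^ 2 ∧
      HasDerivAt φ (φ v * F v / (v * F v + φ v ^ 2)) v)
    (hφa : m * a ≤ φ a ^ 2) (hφb : φ b ^ 2 ≤ m * b) :
    φ a / m + a / φ a ≤ 2 * √(b / m) := by
  have hcont : ContinuousOn (fun v => φ v ^ 2 - m * v) (Set.Icc a b) := by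
    have : ContinuousOn φ (Set.Icc a b) :=
      fun v hv => (hp v hv).2.2.continuousAt.continuousWithinAt
    fun_prop
  obtain ⟨c, hc, hc0⟩ := intermediate_value_Icc' hab hcont
    (show (0 : ℝ) ∈ Set.Icc _ _ from ⟨by linarith, by linarith⟩)
  have hsub : ∀ v ∈ Set.Icc a c, v ∈ Set.Icc a b := fun v hv => ⟨hv.1, hv.2.trans hc.2⟩
  refine (div_add_div_le_of_hasDerivAt hm hc.1 (fun v hv => hF v (hsub v hv))
    fun v hv => hp v (hsub v hv)).trans ?_
  have h0 := (hp c hc).1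
  have hcm : φ c ^ 2 = m * c := by linarith
  have h1 : c / φ c = φ c / m := by
    rw [div_eq_div_iff h0.ne' hm.ne']
    linarith
  have h2 : φ c / m ≤ √(b / m) := by
    apply Real.le_sqrt_of_sq_le
    rw [div_pow, hcm, sq, mul_div_mul_left _ _ hm.ne']
    gcongr
    exact hc.2
  rw [h1]
  linarith

/-- The larger root of `z² / m - 2 √(b / m) z + a` bounds the region where it is nonpositive. -/
theorem le_sqrt_mul_of_div_add_div_le {a b m z : ℝ} (hm : 0 < m) (hb : 0 ≤ b) (hz : 0 < z)
    (h : z / m + a / z ≤ 2 * √(b / m)) : z ≤ √m * (√b + √(b - a)) := by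
  have hs : 0 < √m := Real.sqrt_pos.2 hm
  have hsm : √m ^ 2 = m := Real.sq_sqrt hm.le
  rw [Real.sqrt_div hb] at h
  have h1 : z ^ 2 + a * m ≤ 2 * √b * √m * z := by
    have := mul_le_mul_of_nonneg_right h (mul_pos hm hz).le
    have e1 : (z / m + a / z) * (m * z) = z ^ 2 + a * m := by field_simp
    have e2 : 2 * (√b / √m) * (m * z) = 2 * √b * √m * z := by
      nth_rewrite 2 [← hsm]
      field_simp
    linarith
  have h2 : z / √m - √b ≤ √(b - a) := by
    apply Real.le_sqrt_of_sq_le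
    have e : (z / √m - √b) ^ 2 = (z ^ 2 - 2 * √b * √m * z) / m + b := by
      nth_rewrite 3 [← hsm]
      rw [sub_sq, Real.sq_sqrt hb, div_pow]
      field_simp
    rw [e]
    have : (z ^ 2 - 2 * √b * √m * z) / m ≤ -a := by
      rw [div_le_iff₀ hm]
      linarith
    linarith
  have h3 : z / √m ≤ √b + √(b - a) := by linarith
  rw [div_le_iff₀ hs] at h3
  linarith

/-- Upper bound at `0` for the stable separatrix.  Let `α < -3·4^(-1/3)`, `-1 < λ < 0`,
let `v₃0` be the largest root of `f(v,α) = 0` and `v₃l` the largest root of `f(v,α) = λ`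
(so `0 < v₃l < v₃0`), and set `z₃ = √(-λ)(√v₃0 + √(v₃0 - v₃l))`.  If `φ : (0,v₃0) → ℝ`
solves `dz/dv = z f/(v f + z²)` with `φ > 0`, `v f + φ² > 0` and `φ → 0` at `v₃0⁻`, then
`limsup_{v→0⁺} φ(v) ≤ z₃ + v₃l/z₃`. -/
theorem separatrix_plus_upper_bound (α lam : ℝ)
    (hα : α < -3 * (4 : ℝ) ^ (-(1 : ℝ) / 3))
    (hlam₁ : -1 < lam) (hlam₂ : lam < 0)
    (v₃0 v₃l : ℝ)
    (hv₃0 : v₃0 ^ 3 - α * v₃0 ^ 2 - 1 = 0 ∧ ∀ v : ℝ, v ^ 3 - α * v ^ 2 - 1 = 0 → v ≤ v₃0)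
    (hv₃l : v₃l ^ 3 - α * v₃l ^ 2 - 1 = lam ∧
      ∀ v : ℝ, v ^ 3 - α * v ^ 2 - 1 = lam → v ≤ v₃l)
    (hpos : 0 < v₃l) (hlt : v₃l < v₃0)
    (φ : ℝ → ℝ)
    (hp : ∀ v ∈ Set.Ioo (0 : ℝ) v₃0, 0 < φ v ∧
      0 < v * (v ^ 3 - α * v ^ 2 - 1) + (φ v) ^ 2 ∧
      HasDerivAt φ
        (φ v * (v ^ 3 - α * v ^ 2 - 1) / (v * (v ^ 3 - α * v ^ 2 - 1) + (φ v) ^ 2)) v)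
    (hlim : Tendsto φ (𝓝[Set.Ioo (0 : ℝ) v₃0] v₃0) (𝓝 0)) :
    Filter.limsup (fun v => ((φ v : ℝ) : EReal)) (𝓝[Set.Ioo (0 : ℝ) v₃0] 0) ≤
      ((Real.sqrt (-lam) * (Real.sqrt v₃0 + Real.sqrt (v₃0 - v₃l)) +
        v₃l / (Real.sqrt (-lam) * (Real.sqrt v₃0 + Real.sqrt (v₃0 - v₃l))) : ℝ) : EReal) := by
  have hα0 : α < 0 := by
    have : (0 : ℝ) < 4 ^ (-(1 : ℝ) / 3) := by positivity
    linarith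
  set F : ℝ → ℝ := fun v => v ^ 3 - α * v ^ 2 - 1 with hFdef
  set m := -lam with hm_def
  have hm : 0 < m := by linarith
  have hv0 : 0 < v₃0 := hpos.trans hlt
  have hF1 : ∀ v : ℝ, 0 < v → -1 ≤ F v := fun v hv => by
    have := mul_pos (neg_pos.2 hα0) (pow_pos hv 2)
    have := pow_pos hv 3
    simp only [hFdef]
    linarith
  have hFm : ∀ v : ℝ, v₃l ≤ v → -m ≤ F v := fun v hv => by
    have h3 : v₃l ^ 3 ≤ v ^ 3 := by gcongr
    have h2 : v₃l ^ 2 ≤ v ^ 2 := by gcongr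
    have := mul_le_mul_of_nonneg_left h2 (neg_pos.2 hα0).le
    simp only [hFdef]
    linarith [hv₃l.1]
  set z := √m * (√v₃0 + √(v₃0 - v₃l)) with hz_def
  have hz : 0 < z := by
    have := Real.sqrt_pos.2 hm
    have := Real.sqrt_pos.2 hv0
    positivity
  obtain ⟨hl0, hlD, -⟩ := hp v₃l ⟨hpos, hlt⟩
  have hφz : φ v₃l ≤ z := by
    have hmv : 0 < √(m * v₃l) := Real.sqrt_pos.2 (mul_pos hm hpos)
    have hmem : ∀ᶠ v in 𝓝[Set.Ioo (0 : ℝ) v₃0] v₃0, v ∈ Set.Ioo 0 v₃0 := self_mem_nhdsWithin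
    have hgt : ∀ᶠ v in 𝓝[Set.Ioo (0 : ℝ) v₃0] v₃0, v₃l < v :=
      nhdsWithin_le_nhds (lt_mem_nhds hlt)
    have : (𝓝[Set.Ioo (0 : ℝ) v₃0] v₃0).NeBot := right_nhdsWithin_Ioo_neBot hv0
    obtain ⟨b, ⟨hφb, hb⟩, hlb⟩ :=
      (((hlim.eventually (gt_mem_nhds hmv)).and hmem).and hgt).exists
    have hb2 : φ b ^ 2 ≤ m * b := by
      have h1 : φ b ^ 2 ≤ √(m * v₃l) ^ 2 := pow_le_pow_left₀ (hp b hb).1.le hφb.le 2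
      rw [Real.sq_sqrt (mul_pos hm hpos).le] at h1
      exact h1.trans (by gcongr)
    have ha2 : m * v₃l ≤ φ v₃l ^ 2 := by
      rw [hv₃l.1] at hlD
      linarith
    have := div_add_div_le_of_crosses_parabola (F := F) hm hlb.le
      (fun v hv => hFm v hv.1) (fun v hv => hp v ⟨hpos.trans_le hv.1, hv.2.trans_lt hb.2⟩) ha2 hb2
    refine le_sqrt_mul_of_div_add_div_le hm hv0.le hl0 (this.trans ?_)
    have := hb.2.le
    gcongr
  have hamgm : 2 * √v₃l ≤ z + v₃l / z := by
    have h : (2 * √v₃l) * z ≤ z ^ 2 + v₃l := by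
      nlinarith [sq_nonneg (z - √v₃l), Real.sq_sqrt hpos.le]
    have e : z + v₃l / z = (z ^ 2 + v₃l) / z := by field_simp
    rw [e, le_div_iff₀ hz]
    exact h
  have key : ∀ v ∈ Set.Ioo 0 v₃l, φ v ≤ z + v₃l / z := by
    intro v hv
    have hφv := (hp v ⟨hv.1, hv.2.trans hlt⟩).1
    have hpI : ∀ w ∈ Set.Icc v v₃l, 0 < φ w ∧ 0 < w * F w + φ w ^ 2 ∧
        HasDerivAt φ (φ w * F w / (w * F w + φ w ^ 2)) w :=
      fun w hw => hp w ⟨hv.1.trans_le hw.1, hw.2.trans_lt hlt⟩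
    have hFI : ∀ w ∈ Set.Icc v v₃l, -1 ≤ F w := fun w hw => hF1 w (hv.1.trans_le hw.1)
    have hle : φ v ≤ φ v / 1 + v / φ v := by
      have := div_pos hv.1 hφv
      rw [div_one]
      linarith
    rcases le_or_gt v₃l (φ v₃l ^ 2) with hA | hB
    · refine hle.trans ((div_add_div_le_of_hasDerivAt one_pos hv.2.le hFI hpI).trans ?_)
      rw [div_one]
      have e : z + v₃l / z - (φ v₃l + v₃l / φ v₃l) =
          (z - φ v₃l) * (z * φ v₃l - v₃l) / (z * φ v₃l) := by
        field_simp
        ring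
      have h1 : 0 ≤ z * φ v₃l - v₃l := by nlinarith
      have h2 : 0 ≤ z - φ v₃l := by linarith
      have : 0 ≤ z + v₃l / z - (φ v₃l + v₃l / φ v₃l) := by
        rw [e]
        positivity
      linarith
    · rcases le_or_gt (φ v ^ 2) v with hC | hC
      · have h1 : φ v ≤ √v₃l := Real.le_sqrt_of_sq_le (hC.trans hv.2.le)
        linarith [Real.sqrt_nonneg v₃l]
      · have := div_add_div_le_of_crosses_parabola one_pos hv.2.le hFI hpI
          (by linarith) (by linarith)
        rw [div_one v₃l] at this
        linarith
  refine Filter.limsup_le_of_le (by isBoundedDefault) ?_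
  have hmem : ∀ᶠ v in 𝓝[Set.Ioo (0 : ℝ) v₃0] 0, v ∈ Set.Ioo 0 v₃0 := self_mem_nhdsWithin
  have hlt' : ∀ᶠ v in 𝓝[Set.Ioo (0 : ℝ) v₃0] 0, v < v₃l :=
    nhdsWithin_le_nhds (gt_mem_nhds hpos)
  filter_upwards [hmem, hlt'] with v hv hvl
  exact EReal.coe_le_coe_iff.2 (key v ⟨hv.1, hvl⟩)
end

section
/- Let α = −3/2^{1/3}, and let v₁⁰ < v₂⁰ < v₃⁰ be the three real roots of f(v,α) = 0. Suppose φ⁻ : (v₁⁰, 0] → ℝ is continuous, differentiable on (v₁⁰, 0), with φ⁻ > 0, v·f(v,α) + (φ⁻)² > 0 and (φ⁻)′(v) = φ⁻(v)·f(v,α)/(v·f(v,α) + φ⁻(v)²) on (v₁⁰,0), and φ⁻(v) → 0 as v → v₁⁰⁺; and suppose φ⁺ : (0, v₃⁰) → ℝ is differentiable with φ⁺ > 0, v·f(v,α) + (φ⁺)² > 0 and (φ⁺)′(v) = φ⁺(v)·f(v,α)/(v·f(v,α) + φ⁺(v)²) on (0,v₃⁰), and φ⁺(v) → 0 as v → v₃⁰⁻.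 Then φ⁻(0) > limsup_{v→0⁺} φ⁺(v); in fact φ⁻(0) ≥ 2^{1/3}·√33·(√(√5+2)/8 − (4/33)·√(√5−2)) ≈ 1.4358 and limsup_{v→0⁺} φ⁺(v) ≤ (25/12 − (7/24)·√(3−√3))·√(√3−1)/2^{1/6} ≈ 1.3377. -/
open Filter Topology

/-- A function that tends to `0` at the left end of an interval and is nondecreasing wherever it is
negative is nonnegative. -/
theorem nonneg_of_deriv_nonneg_of_neg {D D' : ℝ → ℝ} {a b : ℝ}
    (hD : ∀ v ∈ Set.Ioo a b, HasDerivAt D (D' v) v)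
    (hD' : ∀ v ∈ Set.Ioo a b, D v < 0 → 0 ≤ D' v)
    (hlim : Tendsto D (𝓝[Set.Ioo a b] a) (𝓝 0)) :
    ∀ v ∈ Set.Ioo a b, 0 ≤ D v := by
  intro x hx
  by_contra! hneg
  have hab : a < b := hx.1.trans hx.2
  rw [nhdsWithin_Ioo_eq_nhdsGT hab] at hlim
  obtain ⟨t, ht, hta, htx⟩ := ((hlim.eventually_const_lt (u := D x / 2) (by linarith)).and
    (Ioo_mem_nhdsGT hx.1)).exists
  have hsub : ∀ s ∈ Set.Icc t x, s ∈ Set.Ioo a b :=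
    fun s hs => ⟨hta.trans_le hs.1, hs.2.trans_lt hx.2⟩
  have hlen : 0 < x - t := by linarith
  have hε : 0 < -D x / (4 * (x - t)) := div_pos (by linarith) (by linarith)
  have key := image_le_of_deriv_right_lt_deriv_boundary (f := fun s => -D s)
    (f' := fun s => -D' s) (a := t) (b := x)
    (fun s hs => (hD s (hsub s hs)).continuousAt.neg.continuousWithinAt)
    (fun s hs => (hD s (hsub s ⟨hs.1, hs.2.le⟩)).neg.hasDerivWithinAt)
    (B := fun s => -D x / 2 + -D x / (4 * (x - t)) * (s - t))
    (B' := fun _ => -D x / (4 * (x - t))) (by simp; linarith)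
    (fun s => by
      simpa using ((((hasDerivAt_id s).sub_const t).const_mul
        (-D x / (4 * (x - t)))).const_add (-D x / 2)))
    (fun s hs hs' => by
      have h1 : 0 ≤ -D x / (4 * (x - t)) * (s - t) :=
        mul_nonneg hε.le (by linarith [hs.1])
      have h2 := hD' s (hsub s ⟨hs.1, hs.2.le⟩) (by linarith)
      linarith)
    (Set.right_mem_Icc.mpr htx.le)
  have h3 : -D x / (4 * (x - t)) * (x - t) = -D x / 4 := by
    field_simp
  simp only [h3] at key
  linarith

/-- A function that tends to `0` at the right end of an interval and is nondecreasing wherever it is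
positive is nonpositive. -/
theorem nonpos_of_deriv_nonneg_of_pos {D D' : ℝ → ℝ} {a b : ℝ}
    (hD : ∀ v ∈ Set.Ioo a b, HasDerivAt D (D' v) v)
    (hD' : ∀ v ∈ Set.Ioo a b, 0 < D v → 0 ≤ D' v)
    (hlim : Tendsto D (𝓝[Set.Ioo a b] b) (𝓝 0)) :
    ∀ v ∈ Set.Ioo a b, D v ≤ 0 := by
  have hmem : ∀ s ∈ Set.Ioo (-b) (-a), -s ∈ Set.Ioo a b :=
    fun s hs => ⟨by linarith [hs.2], by linarith [hs.1]⟩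
  have hneg : Tendsto (fun s : ℝ => -s) (𝓝[Set.Ioo (-b) (-a)] (-b)) (𝓝[Set.Ioo a b] b) := by
    refine tendsto_nhdsWithin_iff.mpr ⟨?_, eventually_mem_nhdsWithin.mono hmem⟩
    simpa using (continuous_neg.tendsto (-b)).mono_left nhdsWithin_le_nhds
  have key := nonneg_of_deriv_nonneg_of_neg (D := fun s => -D (-s)) (D' := fun s => D' (-s))
    (a := -b) (b := -a)
    (fun s hs => by
      have h := ((hD _ (hmem s hs)).comp s (hasDerivAt_neg s)).neg
      rw [mul_neg_one, neg_neg] at h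
      exact h)
    (fun s hs h => hD' _ (hmem s hs) (by linarith))
    (by simpa using (hlim.comp hneg).neg)
  intro v hv
  have := key (-v) ⟨by linarith [hv.2], by linarith [hv.1]⟩
  simp only [neg_neg] at this
  linarith

/-- The quadratic factor of the cubic, normalised so that the cubic is `-c (1 + c v) q`. -/
noncomputable def quadFactor (c v : ℝ) : ℝ := (2 - 2 * c * v - c ^ 2 * v ^ 2) / (2 * c)

theorem continuous_quadFactor (c : ℝ) : Continuous (quadFactor c) := by
  unfold quadFactor
  fun_prop

theorem hasDerivAt_quadFactor {c : ℝ} (hc : 0 < c) (v : ℝ) :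
    HasDerivAt (quadFactor c) (-(1 + c * v)) v := by
  unfold quadFactor
  have h := ((((hasDerivAt_id v).const_mul (2 * c)).const_sub 2).sub
    (((hasDerivAt_id v).pow 2).const_mul (c ^ 2))).div_const (2 * c)
  refine h.congr_deriv ?_
  simp only [id_eq]
  field_simp
  push_cast
  ring

theorem cubic_eq_quadFactor {c : ℝ} (hc : 0 < c) (hc3 : c ^ 3 = 2) (v : ℝ) :
    v ^ 3 - (-3 / c) * v ^ 2 - 1 = -(c * (1 + c * v) * quadFactor c v) := by
  unfold quadFactor
  field_simp
  linear_combination (-c * v ^ 3 - 3 * v ^ 2) * hc3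

theorem quadFactor_eq (c v : ℝ) :
    quadFactor c v = (√3 - 1 - c * v) * (√3 + 1 + c * v) / (2 * c) := by
  unfold quadFactor
  congr 1
  linear_combination -(Real.sq_sqrt (show (0 : ℝ) ≤ 3 by norm_num))

theorem quadFactor_pos {c v : ℝ} (hc : 0 < c) (h₁ : (-1 - √3) / c < v) (h₃ : v < (√3 - 1) / c) :
    0 < quadFactor c v := by
  rw [div_lt_iff₀ hc] at h₁
  rw [lt_div_iff₀ hc] at h₃
  rw [quadFactor_eq]
  exact div_pos (mul_pos (by linarith) (by linarith)) (by linarith)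

theorem quadFactor_left {c : ℝ} (hc : 0 < c) : quadFactor c ((-1 - √3) / c) = 0 := by
  rw [quadFactor_eq, mul_div_cancel₀ _ hc.ne']
  ring

theorem quadFactor_right {c : ℝ} (hc : 0 < c) : quadFactor c ((√3 - 1) / c) = 0 := by
  rw [quadFactor_eq, mul_div_cancel₀ _ hc.ne']
  simp

/-- The extreme roots of the cubic. -/
theorem extreme_roots {c : ℝ} (hc : 0 < c) (hc3 : c ^ 3 = 2) {v₁ v₂ v₃ : ℝ}
    (h₁₂ : v₁ < v₂) (h₂₃ : v₂ < v₃)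
    (hroots : ∀ v : ℝ, v ^ 3 - (-3 / c) * v ^ 2 - 1 = 0 ↔ v = v₁ ∨ v = v₂ ∨ v = v₃) :
    v₁ = (-1 - √3) / c ∧ v₃ = (√3 - 1) / c := by
  have h3 : (0 : ℝ) < √3 := Real.sqrt_pos.mpr (by norm_num)
  have hl : (-1 - √3) / c = v₁ ∨ (-1 - √3) / c = v₂ ∨ (-1 - √3) / c = v₃ := by
    rw [← hroots, cubic_eq_quadFactor hc hc3, quadFactor_left hc]; simp
  have hr : (√3 - 1) / c = v₁ ∨ (√3 - 1) / c = v₂ ∨ (√3 - 1) / c = v₃ := by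
    rw [← hroots, cubic_eq_quadFactor hc hc3, quadFactor_right hc]; simp
  have hbound : ∀ v, v ^ 3 - (-3 / c) * v ^ 2 - 1 = 0 →
      (-1 - √3) / c ≤ v ∧ v ≤ (√3 - 1) / c := by
    intro v hv
    rw [cubic_eq_quadFactor hc hc3, quadFactor_eq] at hv
    rw [div_le_iff₀ hc, le_div_iff₀ hc]
    have : (1 + c * v = 0 ∨ √3 - 1 - c * v = 0) ∨ √3 + 1 + c * v = 0 := by
      simpa [hc.ne', or_assoc] using hv
    rcases this with (h | h) | h <;> constructor <;> linarith
  have b1 := (hbound v₁ ((hroots v₁).mpr (by simp))).1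
  have b3 := (hbound v₃ ((hroots v₃).mpr (by simp))).2
  constructor
  · rcases hl with h | h | h <;> linarith
  · rcases hr with h | h | h <;> linarith

/-- Derivative of `z² - k q` along a solution of the separatrix equation. -/
theorem hasDerivAt_sq_sub_quadFactor {c : ℝ} (hc : 0 < c) (hc3 : c ^ 3 = 2) (k : ℝ)
    {φ : ℝ → ℝ} {v : ℝ}
    (hden : 0 < v * (v ^ 3 - (-3 / c) * v ^ 2 - 1) + φ v ^ 2)
    (hφ : HasDerivAt φ (φ v * (v ^ 3 - (-3 / c) * v ^ 2 - 1) /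
      (v * (v ^ 3 - (-3 / c) * v ^ 2 - 1) + φ v ^ 2)) v) :
    HasDerivAt (fun s => φ s ^ 2 - k * quadFactor c s)
      ((1 + c * v) * ((φ v ^ 2 - k * quadFactor c v) * (k - 3 + (1 + c * v) ^ 2) +
        k * quadFactor c v * (k - 3 + (1 + c * v))) /
        (v * (v ^ 3 - (-3 / c) * v ^ 2 - 1) + φ v ^ 2)) v := by
  refine ((hφ.pow 2).sub ((hasDerivAt_quadFactor hc v).const_mul k)).congr_deriv ?_
  have hq : 2 * c * quadFactor c v = 3 - (1 + c * v) ^ 2 := by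
    unfold quadFactor
    field_simp
    ring
  rw [cubic_eq_quadFactor hc hc3] at hden ⊢
  rw [eq_div_iff hden.ne', sub_mul]
  simp only [Nat.cast_ofNat, Nat.add_one_sub_one, pow_one]
  rw [mul_assoc (2 * φ v), div_mul_cancel₀ _ hden.ne']
  generalize quadFactor c v = q at *
  linear_combination -((1 + c * v) * φ v ^ 2) * hq

theorem unstable_separatrix_sq_ge {c : ℝ} (hc : 0 < c) (hc3 : c ^ 3 = 2) {φ : ℝ → ℝ}
    (hφ : ∀ v ∈ Set.Ioo ((-1 - √3) / c) 0, 0 < φ v ∧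
      0 < v * (v ^ 3 - (-3 / c) * v ^ 2 - 1) + φ v ^ 2 ∧
      HasDerivAt φ (φ v * (v ^ 3 - (-3 / c) * v ^ 2 - 1) /
        (v * (v ^ 3 - (-3 / c) * v ^ 2 - 1) + φ v ^ 2)) v)
    (hlim : Tendsto φ (𝓝[Set.Ioo ((-1 - √3) / c) 0] ((-1 - √3) / c)) (𝓝 0)) :
    ∀ v ∈ Set.Ioo ((-1 - √3) / c) 0, 0 ≤ φ v ^ 2 - 3 * quadFactor c v := by
  have h31 : (1 : ℝ) < √3 := Real.lt_sqrt_of_sq_lt (by norm_num)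
  refine nonneg_of_deriv_nonneg_of_neg
    (fun v hv => hasDerivAt_sq_sub_quadFactor hc hc3 3 (hφ v hv).2.1 (hφ v hv).2.2) ?_ ?_
  · intro v hv hneg
    refine div_nonneg ?_ (hφ v hv).2.1.le
    have hq : 0 < quadFactor c v :=
      quadFactor_pos hc hv.1 (hv.2.trans (div_pos (by linarith) hc))
    have hr : c * v < 0 := mul_neg_of_pos_of_neg hc hv.2
    have hE := sq_nonneg (φ v)
    generalize quadFactor c v = q at *
    generalize φ v ^ 2 = E at *
    have : 0 ≤ (1 + c * v) * (E - 3 * q) + 3 * q := by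
      rcases le_total (1 + c * v) 0 with h | h
      · nlinarith [mul_nonneg_of_nonpos_of_nonpos h hneg.le]
      · nlinarith [mul_nonneg h hE]
    nlinarith [mul_nonneg (sq_nonneg (1 + c * v)) this]
  · have hq := ((continuous_quadFactor c).tendsto ((-1 - √3) / c)).mono_left
      (nhdsWithin_le_nhds (s := Set.Ioo ((-1 - √3) / c) 0))
    rw [quadFactor_left hc] at hq
    simpa using (hlim.pow 2).sub (hq.const_mul 3)

theorem stable_separatrix_sq_le {c : ℝ} (hc : 0 < c) (hc3 : c ^ 3 = 2) {φ : ℝ → ℝ}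
    (hφ : ∀ v ∈ Set.Ioo 0 ((√3 - 1) / c), 0 < φ v ∧
      0 < v * (v ^ 3 - (-3 / c) * v ^ 2 - 1) + φ v ^ 2 ∧
      HasDerivAt φ (φ v * (v ^ 3 - (-3 / c) * v ^ 2 - 1) /
        (v * (v ^ 3 - (-3 / c) * v ^ 2 - 1) + φ v ^ 2)) v)
    (hlim : Tendsto φ (𝓝[Set.Ioo 0 ((√3 - 1) / c)] ((√3 - 1) / c)) (𝓝 0)) :
    ∀ v ∈ Set.Ioo 0 ((√3 - 1) / c), φ v ^ 2 - 2 * quadFactor c v ≤ 0 := by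
  have h3 : (0 : ℝ) < √3 := Real.sqrt_pos.mpr (by norm_num)
  refine nonpos_of_deriv_nonneg_of_pos
    (fun v hv => hasDerivAt_sq_sub_quadFactor hc hc3 2 (hφ v hv).2.1 (hφ v hv).2.2) ?_ ?_
  · intro v hv hpos
    refine div_nonneg ?_ (hφ v hv).2.1.le
    have hq : 0 < quadFactor c v :=
      quadFactor_pos hc ((div_neg_of_neg_of_pos (by linarith) hc).trans hv.1) hv.2
    have hr : 0 < c * v := mul_pos hc hv.1
    refine mul_nonneg (by linarith) (add_nonneg (mul_nonneg hpos.le ?_)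
      (mul_nonneg (by linarith) (by linarith)))
    nlinarith
  · have hq := ((continuous_quadFactor c).tendsto ((√3 - 1) / c)).mono_left
      (nhdsWithin_le_nhds (s := Set.Ioo 0 ((√3 - 1) / c)))
    rw [quadFactor_right hc] at hq
    simpa using (hlim.pow 2).sub (hq.const_mul 2)

theorem unstable_const_le : √33 * (√(√5 + 2) / 8 - (4 / 33) * √(√5 - 2)) ≤ √3 / √2 := by
  have h5 : √5 ≤ 2.2361 := Real.sqrt_le_iff.mpr (by norm_num)
  have h5' : 2.236 ≤ √5 := Real.le_sqrt_of_sq_le (by norm_num)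
  have ha : √(√5 + 2) ≤ 2.0583 := Real.sqrt_le_iff.mpr ⟨by norm_num, by norm_num; linarith⟩
  have hb : 0.48 ≤ √(√5 - 2) := Real.le_sqrt_of_sq_le (by norm_num; linarith)
  have h33 : √33 ≤ 5.75 := Real.sqrt_le_iff.mpr (by norm_num)
  have h2 : √2 ≤ 1.415 := Real.sqrt_le_iff.mpr (by norm_num)
  have h3 : 1.73 ≤ √3 := Real.le_sqrt_of_sq_le (by norm_num)
  rw [le_div_iff₀ (Real.sqrt_pos.mpr (by norm_num))]
  calc √33 * (√(√5 + 2) / 8 - (4 / 33) * √(√5 - 2)) * √2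
      ≤ √33 * 0.2 * √2 := by gcongr; linarith
    _ ≤ 5.75 * 0.2 * 1.415 := by gcongr
    _ ≤ √3 := by linarith

theorem sqrt_two_le_stable_const :
    √2 ≤ (25 / 12 - (7 / 24) * √(3 - √3)) * √(√3 - 1) := by
  have h3 : 1.73 ≤ √3 := Real.le_sqrt_of_sq_le (by norm_num)
  have ha : √(3 - √3) ≤ 1.13 := Real.sqrt_le_iff.mpr ⟨by norm_num, by norm_num; linarith⟩
  have hb : 0.85 ≤ √(√3 - 1) := Real.le_sqrt_of_sq_le (by norm_num; linarith)
  have h2 : √2 ≤ 1.415 := Real.sqrt_le_iff.mpr (by norm_num)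
  calc √2 ≤ 1.75 * 0.85 := by linarith
    _ ≤ _ := by gcongr <;> linarith

/-- At `α = -3/2^(1/3)` the unstable separatrix lies above the stable one at `v = 0`:
`φ⁻(0) > limsup_{v→0⁺} φ⁺(v)`; in fact `φ⁻(0) ≥ 2^(1/3)√33(√(√5+2)/8 - (4/33)√(√5-2))`
and `limsup_{v→0⁺} φ⁺(v) ≤ (25/12 - (7/24)√(3-√3))·√(√3-1)/2^(1/6)`. -/
theorem separatrix_gap_at_special_alpha (α : ℝ)
    (hα : α = -3 / (2 : ℝ) ^ ((1 : ℝ) / 3))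
    (v₁ v₂ v₃ : ℝ) (h₁₂ : v₁ < v₂) (h₂₃ : v₂ < v₃)
    (hroots : ∀ v : ℝ, v ^ 3 - α * v ^ 2 - 1 = 0 ↔ v = v₁ ∨ v = v₂ ∨ v = v₃)
    (φm φp : ℝ → ℝ)
    (hmcont : ContinuousOn φm (Set.Ioc v₁ (0 : ℝ)))
    (hmp : ∀ v ∈ Set.Ioo v₁ (0 : ℝ), 0 < φm v ∧
      0 < v * (v ^ 3 - α * v ^ 2 - 1) + (φm v) ^ 2 ∧
      HasDerivAt φm
        (φm v * (v ^ 3 - α * v ^ 2 - 1) / (v * (v ^ 3 - α * v ^ 2 - 1) + (φm v) ^ 2)) v)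
    (hmlim : Tendsto φm (𝓝[Set.Ioo v₁ (0 : ℝ)] v₁) (𝓝 0))
    (hpp : ∀ v ∈ Set.Ioo (0 : ℝ) v₃, 0 < φp v ∧
      0 < v * (v ^ 3 - α * v ^ 2 - 1) + (φp v) ^ 2 ∧
      HasDerivAt φp
        (φp v * (v ^ 3 - α * v ^ 2 - 1) / (v * (v ^ 3 - α * v ^ 2 - 1) + (φp v) ^ 2)) v)
    (hplim : Tendsto φp (𝓝[Set.Ioo (0 : ℝ) v₃] v₃) (𝓝 0)) :
    Filter.limsup (fun v => ((φp v : ℝ) : EReal)) (𝓝[Set.Ioo (0 : ℝ) v₃] 0)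
      < ((φm 0 : ℝ) : EReal) ∧
    (2 : ℝ) ^ ((1 : ℝ) / 3) * Real.sqrt 33 *
        (Real.sqrt (Real.sqrt 5 + 2) / 8 - (4 / 33) * Real.sqrt (Real.sqrt 5 - 2)) ≤ φm 0 ∧
    Filter.limsup (fun v => ((φp v : ℝ) : EReal)) (𝓝[Set.Ioo (0 : ℝ) v₃] 0) ≤
      (((25 / 12 - (7 / 24) * Real.sqrt (3 - Real.sqrt 3)) *
        Real.sqrt (Real.sqrt 3 - 1) / (2 : ℝ) ^ ((1 : ℝ) / 6) : ℝ) : EReal) := by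
  obtain ⟨d, hd⟩ : ∃ d, d = (2 : ℝ) ^ ((1 : ℝ) / 6) := ⟨_, rfl⟩
  obtain ⟨c, hcdef⟩ : ∃ c, c = (2 : ℝ) ^ ((1 : ℝ) / 3) := ⟨_, rfl⟩
  have hd0 : 0 < d := hd ▸ by positivity
  have hc : 0 < c := hcdef ▸ by positivity
  have hdc : d ^ 2 = c := by
    rw [hd, hcdef, ← Real.rpow_natCast, ← Real.rpow_mul (by norm_num)]; norm_num
  have hc3 : c ^ 3 = 2 := by
    rw [hcdef, ← Real.rpow_natCast, ← Real.rpow_mul (by norm_num)]; norm_num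
  have hcd : c = √2 / d := by
    rw [eq_div_iff hd0.ne', eq_comm, Real.sqrt_eq_iff_mul_self_eq (by norm_num) (by positivity)]
    linear_combination -(c ^ 2) * hdc - hc3
  rw [← hcdef] at hα ⊢
  rw [← hd]
  subst hα
  obtain ⟨rfl, rfl⟩ := extreme_roots hc hc3 h₁₂ h₂₃ hroots
  have h31 : (1 : ℝ) < √3 := Real.lt_sqrt_of_sq_lt (by norm_num)
  have hleft : (-1 - √3) / c < 0 := div_neg_of_neg_of_pos (by linarith) hc
  have hq0 : quadFactor c 0 = 1 / c := by
    unfold quadFactor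
    field_simp
    ring
  have hm0 : √3 / d ≤ φm 0 := by
    have hne : (𝓝[Set.Ioo ((-1 - √3) / c) 0] (0 : ℝ)).NeBot := by
      rw [nhdsWithin_Ioo_eq_nhdsLT hleft]; infer_instance
    have hcont : Tendsto φm (𝓝[Set.Ioo ((-1 - √3) / c) 0] 0) (𝓝 (φm 0)) :=
      (hmcont 0 ⟨hleft, le_rfl⟩).mono Set.Ioo_subset_Ioc_self
    have hpos : 0 ≤ φm 0 := ge_of_tendsto hcont
      (eventually_mem_nhdsWithin.mono fun v hv => (hmp v hv).1.le)
    have hsq : 0 ≤ φm 0 ^ 2 - 3 * quadFactor c 0 := ge_of_tendsto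
      ((hcont.pow 2).sub ((((continuous_quadFactor c).tendsto 0).mono_left
        nhdsWithin_le_nhds).const_mul 3))
      (eventually_mem_nhdsWithin.mono (unstable_separatrix_sq_ge hc hc3 hmp hmlim))
    refine (sq_le_sq₀ (by positivity) hpos).mp ?_
    rw [div_pow, Real.sq_sqrt (by norm_num), hdc]
    rw [hq0] at hsq
    linarith [show 3 * (1 / c) = 3 / c by ring]
  have hp0 : limsup (fun v => ((φp v : ℝ) : EReal)) (𝓝[Set.Ioo (0 : ℝ) ((√3 - 1) / c)] 0) ≤
      ((√2 / d : ℝ) : EReal) := by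
    refine limsup_le_of_le (by isBoundedDefault) (eventually_mem_nhdsWithin.mono fun v hv => ?_)
    rw [EReal.coe_le_coe_iff]
    refine (sq_le_sq₀ (hpp v hv).1.le (by positivity)).mp ?_
    rw [div_pow, Real.sq_sqrt (by norm_num), hdc]
    have hle := stable_separatrix_sq_le hc hc3 hpp hplim v hv
    have hq : quadFactor c v ≤ 1 / c := by
      have := mul_pos hc hv.1
      unfold quadFactor
      rw [div_le_div_iff₀ (by positivity) hc]
      nlinarith [mul_nonneg hc.le (sq_nonneg (c * v)), mul_pos hc this]
    linarith [show 2 * (1 / c) = 2 / c by ring]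
  refine ⟨hp0.trans_lt (EReal.coe_lt_coe_iff.mpr (lt_of_lt_of_le ?_ hm0)), le_trans ?_ hm0,
    hp0.trans (EReal.coe_le_coe_iff.mpr ?_)⟩
  · gcongr
    norm_num
  · calc c * √33 * (√(√5 + 2) / 8 - 4 / 33 * √(√5 - 2))
        = c * (√33 * (√(√5 + 2) / 8 - 4 / 33 * √(√5 - 2))) := by ring
      _ ≤ c * (√3 / √2) := by gcongr; exact unstable_const_le
      _ = √3 / d := by
        rw [hcd]
        field_simp
  · gcongr
    exact sqrt_two_le_stable_const
end

section
/- There exists a unique real number α* ∈ (−∞, −3·4^{−1/3}) with the following property: the transformed system dv/dτ = v·f(v,α*) + z², dz/dτ = z·f(v,α*) admits a solution (v,z) : ℝ → ℝ² with z(τ) > 0 for all τ ∈ ℝ, such that (v(τ), z(τ)) → (v₁⁰(α*), 0) as τ → −∞ and (v(τ), z(τ)) → (v₃⁰(α*), 0) as τ → +∞, where v₁⁰(α*) and v₃⁰(α*) are the smallest and largest real roots of f(v,α*) = 0. Moreover this α* satisfies −3/2^{1/3} < α* ≤ −3·((6√3−9)/4)^{1/3}. -/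
open Filter Topology

/-- `f(v,α) = v³ - αv² - 1`. -/
noncomputable def fcubic (v α : ℝ) : ℝ := v ^ 3 - α * v ^ 2 - 1

/-- The transformed system `dv/dτ = v f(v,α) + z²`, `dz/dτ = z f(v,α)` admits a heteroclinic
solution in the upper half plane, joining the saddle at the smallest root of `f(·,α)` (as
`τ → -∞`) with the saddle at the largest root (as `τ → +∞`). -/
def HasHeteroclinic (α : ℝ) : Prop :=
  ∃ v z : ℝ → ℝ, ∃ v₁ v₃ : ℝ,
    (fcubic v₁ α = 0 ∧ ∀ w : ℝ, fcubic w α = 0 → v₁ ≤ w) ∧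
    (fcubic v₃ α = 0 ∧ ∀ w : ℝ, fcubic w α = 0 → w ≤ v₃) ∧
    (∀ τ : ℝ, HasDerivAt v (v τ * fcubic (v τ) α + (z τ) ^ 2) τ ∧
      HasDerivAt z (z τ * fcubic (v τ) α) τ ∧ 0 < z τ) ∧
    Tendsto (fun τ => (v τ, z τ)) atBot (𝓝 (v₁, 0)) ∧
    Tendsto (fun τ => (v τ, z τ)) atTop (𝓝 (v₃, 0))

section Auxiliary

open Set

/-- The slope `dy/dx` of the trajectories of `ẋ = y`, `ẏ = -x³ + αx²y + y³`. -/
noncomputable def slopeField (α x y : ℝ) : ℝ := y ^ 2 + α * x ^ 2 - x ^ 3 / y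

lemma exists_inverse_hasDerivAt {f f' : ℝ → ℝ} (hf : ∀ x, HasDerivAt f (f' x) x)
    (hpos : ∀ x, 0 < f' x) (hbot : Tendsto f atBot atBot) (htop : Tendsto f atTop atTop) :
    ∃ g : ℝ → ℝ, (∀ x, f (g x) = x) ∧ (∀ x, HasDerivAt g (f' (g x))⁻¹ x) ∧
      Tendsto g atBot atBot ∧ Tendsto g atTop atTop := by
  have hmono : StrictMono f := strictMono_of_hasDerivAt_pos hf hpos
  have hcont : Continuous f := continuous_iff_continuousAt.2 fun x => (hf x).continuousAt
  let e := hmono.orderIsoOfSurjective f (hcont.surjective htop hbot)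
  have he : ∀ x, f (e.symm x) = x := e.apply_symm_apply
  refine ⟨e.symm, he, fun x => ?_, e.symm.tendsto_atBot, e.symm.tendsto_atTop⟩
  exact HasDerivAt.of_local_left_inverse e.symm.continuous.continuousAt (hf _) (hpos _).ne'
    (Eventually.of_forall he)

lemma cube_threshold {α : ℝ} (hα : α < -3 * (4 : ℝ) ^ (-(1 : ℝ) / 3)) : 27 / 4 < (-α) ^ 3 := by
  set t : ℝ := (4 : ℝ) ^ (-(1 : ℝ) / 3) with ht
  have ht0 : 0 < t := by positivity
  have ht3 : t ^ 3 = 1 / 4 := by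
    rw [ht, ← Real.rpow_natCast, ← Real.rpow_mul (by norm_num)]
    norm_num [Real.rpow_neg_one]
  have h : (3 * t) ^ 3 < (-α) ^ 3 := by gcongr; linarith
  nlinarith

lemma min_root_lt {α v c : ℝ} (hα : 27 / 4 < (-α) ^ 3) (hc0 : 0 < c) (hc : c ^ 3 = 2)
    (hv : ∀ w : ℝ, fcubic w α = 0 → v ≤ w) : v < -c := by
  have hα0 : 0 < -α := by
    by_contra h
    have : (-α) ^ 3 ≤ 0 := Odd.pow_nonpos (by decide) (not_lt.1 h)
    linarith
  have hpos : 0 < fcubic (-c) α := by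
    have h1 : 3 < -α * c ^ 2 := by
      have h2 : (3 : ℝ) ^ 3 < (-α * c ^ 2) ^ 3 := by
        have : (-α * c ^ 2) ^ 3 = (-α) ^ 3 * (c ^ 3) ^ 2 := by ring
        rw [this, hc]; linarith
      exact lt_of_pow_lt_pow_left₀ 3 (by positivity) h2
    unfold fcubic
    nlinarith
  have hneg : fcubic (α - 1 - c) α < 0 := by
    unfold fcubic
    have : (α - 1 - c) ^ 3 - α * (α - 1 - c) ^ 2 = -(1 + c) * (1 - α + c) ^ 2 := by ring
    nlinarith [sq_nonneg (1 - α + c)]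
  have hcont : ContinuousOn (fun w => fcubic w α) (Icc (α - 1 - c) (-c)) := by
    unfold fcubic; fun_prop
  obtain ⟨w, hw, hw0⟩ := intermediate_value_Ioo (by linarith) hcont ⟨hneg, hpos⟩
  exact (hv w hw0).trans_lt hw.2

lemma max_root_pos {α v : ℝ} (hv : ∀ w : ℝ, fcubic w α = 0 → w ≤ v) : 0 < v := by
  have hcont : ContinuousOn (fun w => fcubic w α) (Icc 0 (2 + |α|)) := by
    unfold fcubic; fun_prop
  have hneg : fcubic 0 α < 0 := by norm_num [fcubic]
  have hpos : 0 < fcubic (2 + |α|) α := by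
    unfold fcubic
    have h1 := le_abs_self α
    have h2 := abs_nonneg α
    nlinarith [mul_nonneg (sub_nonneg.2 h1) (sq_nonneg (2 + |α|))]
  obtain ⟨w, hw, hw0⟩ := intermediate_value_Ioo (by positivity) hcont ⟨hneg, hpos⟩
  exact hw.1.trans_le (hv w hw0)

/-- A heteroclinic solution, seen in the original plane, is the graph of a positive solution of
`dy/dx = slopeField α x y`. -/
lemma exists_graph_of_solution {α v₁ v₃ : ℝ} {v z : ℝ → ℝ} (hv₁ : v₁ < 0) (hv₃ : 0 < v₃)
    (hsol : ∀ τ : ℝ, HasDerivAt v (v τ * fcubic (v τ) α + (z τ) ^ 2) τ ∧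
      HasDerivAt z (z τ * fcubic (v τ) α) τ ∧ 0 < z τ)
    (hbot : Tendsto (fun τ => (v τ, z τ)) atBot (𝓝 (v₁, 0)))
    (htop : Tendsto (fun τ => (v τ, z τ)) atTop (𝓝 (v₃, 0))) :
    ∃ y : ℝ → ℝ, (∀ x, 0 < y x) ∧ (∀ x, HasDerivAt y (slopeField α x (y x)) x) ∧
      Tendsto (fun x => x / y x) atBot (𝓝 v₁) ∧ Tendsto (fun x => x / y x) atTop (𝓝 v₃) := by
  have hz : ∀ τ, 0 < z τ := fun τ => (hsol τ).2.2
  have hinv : ∀ {l : Filter ℝ} {c : ℝ}, Tendsto (fun τ => (v τ, z τ)) l (𝓝 (c, 0)) →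
      Tendsto v l (𝓝 c) ∧ Tendsto (fun τ => (z τ)⁻¹) l atTop := by
    intro l c h
    rw [nhds_prod_eq, tendsto_prod_iff'] at h
    refine ⟨h.1, Tendsto.comp tendsto_inv_nhdsGT_zero ?_⟩
    exact tendsto_nhdsWithin_iff.2 ⟨h.2, Eventually.of_forall hz⟩
  obtain ⟨hvb, hzb⟩ := hinv hbot
  obtain ⟨hvt, hzt⟩ := hinv htop
  have hX : ∀ τ, HasDerivAt (fun τ => v τ / z τ) (z τ) τ := by
    intro τ
    have h := (hsol τ).1.div (hsol τ).2.1 (hz τ).ne'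
    refine h.congr_deriv ?_
    rw [div_eq_iff (pow_ne_zero 2 (hz τ).ne')]
    ring
  obtain ⟨T, hT, hT', hTb, hTt⟩ := exists_inverse_hasDerivAt hX hz
    (by simpa [div_eq_mul_inv] using hvb.neg_mul_atTop hv₁ hzb)
    (by simpa [div_eq_mul_inv] using hvt.pos_mul_atTop hv₃ hzt)
  have hdiv : ∀ x, x / (z (T x))⁻¹ = v (T x) := by
    intro x
    rw [div_inv_eq_mul, ← (div_eq_iff (hz (T x)).ne').1 (hT x)]
  refine ⟨fun x => (z (T x))⁻¹, fun x => inv_pos.2 (hz _), fun x => ?_, ?_, ?_⟩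
  · have h := ((hsol (T x)).2.1.comp x (hT' x)).inv (hz (T x)).ne'
    refine h.congr_deriv ?_
    have hx := hT x
    have hne := (hz (T x)).ne'
    simp only [Function.comp, slopeField, fcubic]
    generalize z (T x) = a at *
    generalize v (T x) = b at *
    subst hx
    field_simp
    ring
  · simp only [hdiv]; exact hvb.comp hTb
  · simp only [hdiv]; exact hvt.comp hTt

lemma exists_solution_of_graph {α v₁ v₃ m : ℝ} {y : ℝ → ℝ} (hm : 0 < m)
    (hy : ∀ x, m ≤ y x) (hsol : ∀ x, HasDerivAt y (slopeField α x (y x)) x)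
    (hbot : Tendsto (fun x => x / y x) atBot (𝓝 v₁))
    (htop : Tendsto (fun x => x / y x) atTop (𝓝 v₃)) :
    ∃ v z : ℝ → ℝ, (∀ τ : ℝ, HasDerivAt v (v τ * fcubic (v τ) α + (z τ) ^ 2) τ ∧
      HasDerivAt z (z τ * fcubic (v τ) α) τ ∧ 0 < z τ) ∧
      Tendsto (fun τ => (v τ, z τ)) atBot (𝓝 (v₁, 0)) ∧
      Tendsto (fun τ => (v τ, z τ)) atTop (𝓝 (v₃, 0)) := by
  have hy0 : ∀ x, 0 < y x := fun x => hm.trans_le (hy x)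
  have hcont : Continuous y := continuous_iff_continuousAt.2 fun x => (hsol x).continuousAt
  have hτ : ∀ x, HasDerivAt (fun x => ∫ s in (0 : ℝ)..x, y s) (y x) x := fun x =>
    intervalIntegral.integral_hasDerivAt_right (hcont.intervalIntegrable _ _)
      (hcont.stronglyMeasurableAtFilter _ _) hcont.continuousAt
  have hmono : Monotone (fun x => (∫ s in (0 : ℝ)..x, y s) - m * x) := by
    refine monotone_of_hasDerivAt_nonneg
      (fun x => (hτ x).sub ((hasDerivAt_id x).const_mul m)) fun x => ?_
    simpa using hy x
  obtain ⟨X, hX, hX', hXb, hXt⟩ := exists_inverse_hasDerivAt hτ hy0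
    (by
      refine tendsto_atBot_mono' _ ?_ (tendsto_id.const_mul_atBot hm)
      filter_upwards [eventually_le_atBot 0] with x hx
      have := hmono hx
      simp at this
      simpa using this)
    (by
      refine tendsto_atTop_mono' _ ?_ (tendsto_id.const_mul_atTop hm)
      filter_upwards [eventually_ge_atTop 0] with x hx
      have := hmono hx
      simp at this
      simpa using this)
  have hzero : ∀ {l : Filter ℝ} {c : ℝ}, Tendsto (fun x => x / y x) l (𝓝 c) →
      Tendsto (fun x : ℝ => x⁻¹) l (𝓝 0) → (∀ᶠ x : ℝ in l, x ≠ 0) →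
      Tendsto (fun x => (x / y x, (y x)⁻¹)) l (𝓝 (c, 0)) := by
    intro l c h h0 hne
    refine h.prodMk_nhds ?_
    have := h.mul h0
    rw [mul_zero] at this
    refine this.congr' ?_
    filter_upwards [hne] with x hx
    have := (hy0 x).ne'
    field_simp
  refine ⟨fun τ => X τ / y (X τ), fun τ => (y (X τ))⁻¹, fun τ => ?_, ?_, ?_⟩
  · have hYX := (hsol (X τ)).comp τ (hX' τ)
    have hne := (hy0 (X τ)).ne'
    refine ⟨((hX' τ).div hYX hne).congr_deriv ?_, (hYX.inv hne).congr_deriv ?_,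
      inv_pos.2 (hy0 _)⟩
    · simp only [Function.comp, slopeField, fcubic]
      field_simp
      ring
    · simp only [Function.comp, slopeField, fcubic]
      field_simp
      ring
  · exact (hzero hbot tendsto_inv_atBot_zero (eventually_ne_atBot 0)).comp hXb
  · exact (hzero htop tendsto_inv_atTop_zero (eventually_ne_atTop 0)).comp hXt

lemma slopeField_sub {α β x y w : ℝ} (hy : y ≠ 0) (hw : w ≠ 0) :
    slopeField β x w - slopeField α x y =
      (w - y) * (y + w + x ^ 3 / (y * w)) + (β - α) * x ^ 2 := by
  unfold slopeField
  field_simp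
  ring

lemma not_two_graphs {α β a₁ a₃ b₁ b₃ : ℝ} {y w : ℝ → ℝ} (hαβ : α < β)
    (hy : ∀ x, 0 < y x) (hw : ∀ x, 0 < w x)
    (hy' : ∀ x, HasDerivAt y (slopeField α x (y x)) x)
    (hw' : ∀ x, HasDerivAt w (slopeField β x (w x)) x)
    (hyb : Tendsto (fun x => x / y x) atBot (𝓝 a₁)) (hyt : Tendsto (fun x => x / y x) atTop (𝓝 a₃))
    (hwb : Tendsto (fun x => x / w x) atBot (𝓝 b₁)) (hwt : Tendsto (fun x => x / w x) atTop (𝓝 b₃))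
    (ha₁ : a₁ ≠ 0) (hb₁ : b₁ ≠ 0) (h₁ : 0 < a₁⁻¹ + b₁⁻¹ + a₁ * b₁)
    (ha₃ : 0 < a₃) (hb₃ : 0 < b₃) : False := by
  set G : ℝ → ℝ := fun x => y x + w x + x ^ 3 / (y x * w x) with hG
  set e : ℝ → ℝ := fun x => w x - y x with he
  have hyc : Continuous y := continuous_iff_continuousAt.2 fun x => (hy' x).continuousAt
  have hwc : Continuous w := continuous_iff_continuousAt.2 fun x => (hw' x).continuousAt
  have hGc : Continuous G :=
    (hyc.add hwc).add ((continuous_pow 3).div (hyc.mul hwc) fun x => (mul_pos (hy x) (hw x)).ne')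
  have he' : ∀ x, HasDerivAt e (e x * G x + (β - α) * x ^ 2) x := fun x =>
    ((hw' x).sub (hy' x)).congr_deriv (slopeField_sub (hy x).ne' (hw x).ne')
  have hslope : ∀ {l : Filter ℝ} {a b : ℝ}, Tendsto (fun x => x / y x) l (𝓝 a) →
      Tendsto (fun x => x / w x) l (𝓝 b) → a ≠ 0 → b ≠ 0 → (∀ᶠ x : ℝ in l, x ≠ 0) →
      Tendsto (fun x => G x / x) l (𝓝 (a⁻¹ + b⁻¹ + a * b)) ∧
      Tendsto (fun x => e x / x) l (𝓝 (b⁻¹ - a⁻¹)) := by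
    intro l a b ha hb ha0 hb0 hne
    have ha' := ha.inv₀ ha0
    have hb' := hb.inv₀ hb0
    refine ⟨((ha'.add hb').add (ha.mul hb)).congr' ?_, (hb'.sub ha').congr' ?_⟩
    · filter_upwards [hne] with x hx
      have := (hy x).ne'
      have := (hw x).ne'
      simp only [hG]
      field_simp
    · filter_upwards [hne] with x hx
      simp only [he]
      field_simp
  obtain ⟨hGb, heb⟩ := hslope hyb hwb ha₁ hb₁ (eventually_ne_atBot 0)
  obtain ⟨hGt, het⟩ := hslope hyt hwt ha₃.ne' hb₃.ne' (eventually_ne_atTop 0)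
  have hGbot : Tendsto G atBot atBot := by
    refine (tendsto_id.atBot_mul_pos h₁ hGb).congr' ?_
    filter_upwards [eventually_ne_atBot 0] with x hx
    simp only [id]
    field_simp
  have hGtop : Tendsto G atTop atTop := by
    refine (tendsto_id.atTop_mul_pos (by positivity) hGt).congr' ?_
    filter_upwards [eventually_ne_atTop 0] with x hx
    simp only [id]
    field_simp
  have hhb : Tendsto (fun x => e x * Real.exp x) atBot (𝓝 0) := by
    have hxe : Tendsto (fun x : ℝ => x * Real.exp x) atBot (𝓝 0) := by
      have := (Real.tendsto_pow_mul_exp_neg_atTop_nhds_zero 1).comp tendsto_neg_atBot_atTop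
      simpa [Function.comp_def] using this.neg
    have := heb.mul hxe
    rw [mul_zero] at this
    refine this.congr' ?_
    filter_upwards [eventually_ne_atBot 0] with x hx
    field_simp
  have hht : Tendsto (fun x => e x * Real.exp (-x)) atTop (𝓝 0) := by
    have := het.mul (Real.tendsto_pow_mul_exp_neg_atTop_nhds_zero 1)
    rw [mul_zero] at this
    refine this.congr' ?_
    filter_upwards [eventually_ne_atTop 0] with x hx
    field_simp
  set P : ℝ → ℝ := fun x => e x * Real.exp (-∫ s in (0 : ℝ)..x, G s) with hP
  have hP' : ∀ x, HasDerivAt P ((β - α) * x ^ 2 * Real.exp (-∫ s in (0 : ℝ)..x, G s)) x := by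
    intro x
    have hI : HasDerivAt (fun x => ∫ s in (0 : ℝ)..x, G s) (G x) x :=
      intervalIntegral.integral_hasDerivAt_right (hGc.intervalIntegrable _ _)
        (hGc.stronglyMeasurableAtFilter _ _) hGc.continuousAt
    refine ((he' x).mul hI.neg.exp).congr_deriv ?_
    simp only [Pi.neg_apply]
    ring
  have hPmono : Monotone P := monotone_of_hasDerivAt_nonneg hP' fun x => by
    have := sub_pos.2 hαβ
    positivity
  have hPstrict : StrictMonoOn P (Iic 0) := by
    refine strictMonoOn_of_deriv_pos (convex_Iic 0)
      (fun x _ => (hP' x).continuousAt.continuousWithinAt) fun x hx => ?_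
    rw [interior_Iic] at hx
    rw [(hP' x).deriv]
    have := sub_pos.2 hαβ
    have : 0 < x ^ 2 := by have := (mem_Iio.1 hx).ne; positivity
    positivity
  obtain ⟨x₁, hx₁⟩ := eventually_atBot.1
    ((hGbot.eventually_le_atBot (-1)).and (eventually_le_atBot (0 : ℝ)))
  have hpos₁ : 0 < e x₁ := by
    by_contra hcon
    have hP₁ : P x₁ ≤ 0 := mul_nonpos_of_nonpos_of_nonneg (not_lt.1 hcon) (Real.exp_pos _).le
    have hneg : ∀ x < x₁, e x < 0 := fun x hx => by
      have h := (hPstrict (hx₁ x hx.le).2 (hx₁ x₁ le_rfl).2 hx).trans_le hP₁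
      exact (neg_iff_pos_of_mul_neg h).2 (Real.exp_pos _)
    have hmono : MonotoneOn (fun x => e x * Real.exp x) (Iic (x₁ - 1)) := by
      refine monotoneOn_of_deriv_nonneg (convex_Iic _)
        (fun x _ => ((he' x).continuousAt.mul
          Real.continuous_exp.continuousAt).continuousWithinAt)
        (fun x _ => ((he' x).mul (Real.hasDerivAt_exp x)).differentiableAt.differentiableWithinAt)
        fun x hx => ?_
      rw [interior_Iic] at hx
      have hx' : x < x₁ := by have := mem_Iio.1 hx; linarith
      have h1 := hneg x hx'
      have h2 := (hx₁ x hx'.le).1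
      have hd : HasDerivAt (fun x => e x * Real.exp x) _ x := (he' x).mul (Real.hasDerivAt_exp x)
      rw [hd.deriv]
      have h3 : 0 ≤ e x * (G x + 1) := mul_nonneg_of_nonpos_of_nonpos h1.le (by linarith)
      have h4 : 0 ≤ (β - α) * x ^ 2 := mul_nonneg (sub_pos.2 hαβ).le (sq_nonneg x)
      have h5 := Real.exp_pos x
      have : (e x * G x + (β - α) * x ^ 2) * Real.exp x + e x * Real.exp x =
        (e x * (G x + 1) + (β - α) * x ^ 2) * Real.exp x := by ring
      rw [this]
      positivity
    have hlim : 0 ≤ e (x₁ - 1) * Real.exp (x₁ - 1) := by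
      refine le_of_tendsto hhb ?_
      filter_upwards [eventually_le_atBot (x₁ - 1)] with x hx
      exact hmono hx (mem_Iic.2 le_rfl) hx
    exact absurd hlim (not_le.2 (mul_neg_of_neg_of_pos (hneg _ (by linarith)) (Real.exp_pos _)))
  have hpos : ∀ x, x₁ ≤ x → 0 < e x := fun x hx => by
    have h : 0 < P x := (mul_pos hpos₁ (Real.exp_pos _)).trans_le (hPmono hx)
    exact (pos_iff_pos_of_mul_pos h).2 (Real.exp_pos _)
  obtain ⟨x₃, hx₃⟩ := eventually_atTop.1
    ((hGtop.eventually_ge_atTop 1).and (eventually_ge_atTop x₁))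
  have hmono : MonotoneOn (fun x => e x * Real.exp (-x)) (Ici x₃) := by
    have hd : ∀ x, HasDerivAt (fun x => e x * Real.exp (-x))
        ((e x * (G x - 1) + (β - α) * x ^ 2) * Real.exp (-x)) x := fun x => by
      refine ((he' x).mul (hasDerivAt_neg x).exp).congr_deriv ?_
      ring
    refine monotoneOn_of_deriv_nonneg (convex_Ici _)
      (fun x _ => (hd x).continuousAt.continuousWithinAt)
      (fun x _ => (hd x).differentiableAt.differentiableWithinAt) fun x hx => ?_
    rw [interior_Ici] at hx
    rw [(hd x).deriv]
    have h1 := hx₃ x (mem_Ioi.1 hx).le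
    have h3 : 0 ≤ e x * (G x - 1) := mul_nonneg (hpos x h1.2).le (by linarith [h1.1])
    have h4 : 0 ≤ (β - α) * x ^ 2 := mul_nonneg (sub_pos.2 hαβ).le (sq_nonneg x)
    positivity
  have hlim : e x₃ * Real.exp (-x₃) ≤ 0 := by
    refine ge_of_tendsto hht ?_
    filter_upwards [eventually_ge_atTop x₃] with x hx
    exact hmono (mem_Ici.2 le_rfl) hx hx
  exact absurd hlim (not_le.2 (mul_pos (hpos _ (hx₃ x₃ le_rfl).2) (Real.exp_pos _)))

lemma heteroclinic_not_lt {α β : ℝ} (hα : 27 / 4 < (-α) ^ 3) (hβ : 27 / 4 < (-β) ^ 3)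
    (h : HasHeteroclinic α) (h' : HasHeteroclinic β) : ¬α < β := by
  intro hαβ
  obtain ⟨v, z, a₁, a₃, ha₁, ha₃, hsol, hb, ht⟩ := h
  obtain ⟨v', z', b₁, b₃, hb₁, hb₃, hsol', hb', ht'⟩ := h'
  set c : ℝ := (2 : ℝ) ^ ((1 : ℝ) / 3)
  have hc0 : 0 < c := by positivity
  have hc : c ^ 3 = 2 := by
    rw [← Real.rpow_natCast, ← Real.rpow_mul (by norm_num)]
    norm_num
  have ha := min_root_lt hα hc0 hc ha₁.2
  have hb₁' := min_root_lt hβ hc0 hc hb₁.2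
  obtain ⟨y, hy, hy', hyb, hyt⟩ :=
    exists_graph_of_solution (by linarith) (max_root_pos ha₃.2) hsol hb ht
  obtain ⟨w, hw, hw', hwb, hwt⟩ :=
    exists_graph_of_solution (by linarith) (max_root_pos hb₃.2) hsol' hb' ht'
  refine not_two_graphs hαβ hy hw hy' hw' hyb hyt hwb hwt (by linarith) (by linarith) ?_
    (max_root_pos ha₃.2) (max_root_pos hb₃.2)
  have h1 : ∀ {a : ℝ}, a < -c → -c⁻¹ < a⁻¹ := fun {a} h => by
    rw [← inv_neg]
    exact (inv_lt_inv_of_neg (by linarith) (by linarith)).2 h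
  have h2 : c * c < a₁ * b₁ := by nlinarith
  have h3 : c * c = 2 * c⁻¹ := by field_simp; linarith
  linarith [h1 ha, h1 hb₁']

theorem image_le_of_deriv_lt_of_left {f g f' g' : ℝ → ℝ} {a b : ℝ}
    (hf : ∀ x ∈ Icc a b, HasDerivWithinAt f (f' x) (Icc a b) x)
    (hg : ∀ x ∈ Icc a b, HasDerivWithinAt g (g' x) (Icc a b) x) (hfg : f a ≤ g a)
    (h : ∀ x ∈ Icc a b, f x = g x → f' x < g' x) : ∀ x ∈ Icc a b, f x ≤ g x := by
  intro x hx
  refine image_le_of_deriv_right_lt_deriv_boundary' (f' := f') (B' := g')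
    (fun x hx => (hf x hx).continuousWithinAt)
    (fun x hx => (hf x (Ico_subset_Icc_self hx)).mono_of_mem_nhdsWithin (Icc_mem_nhdsGE_of_mem hx))
    hfg (fun x hx => (hg x hx).continuousWithinAt)
    (fun x hx => (hg x (Ico_subset_Icc_self hx)).mono_of_mem_nhdsWithin (Icc_mem_nhdsGE_of_mem hx))
    (fun x hx => h x (Ico_subset_Icc_self hx)) hx

theorem image_le_of_deriv_lt_of_right {f g f' g' : ℝ → ℝ} {a b : ℝ}
    (hf : ∀ x ∈ Icc a b, HasDerivWithinAt f (f' x) (Icc a b) x)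
    (hg : ∀ x ∈ Icc a b, HasDerivWithinAt g (g' x) (Icc a b) x) (hfg : f b ≤ g b)
    (h : ∀ x ∈ Icc a b, f x = g x → g' x < f' x) : ∀ x ∈ Icc a b, f x ≤ g x := by
  have hmem : ∀ x ∈ Icc (-b) (-a), -x ∈ Icc a b := fun x hx =>
    ⟨by linarith [hx.2], by linarith [hx.1]⟩
  have key : ∀ (u u' : ℝ → ℝ), (∀ x ∈ Icc a b, HasDerivWithinAt u (u' x) (Icc a b) x) →
      ∀ x ∈ Icc (-b) (-a), HasDerivWithinAt (fun x => u (-x)) (-u' (-x)) (Icc (-b) (-a)) x := by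
    intro u u' hu x hx
    have := (hu (-x) (hmem x hx)).scomp x ((hasDerivAt_neg x).hasDerivWithinAt) hmem
    simpa [Function.comp_def] using this
  intro x hx
  have := image_le_of_deriv_lt_of_left (key f f' hf) (key g g' hg) (by simpa using hfg)
    (fun x hx e => neg_lt_neg (h (-x) (hmem x hx) e)) (-x) ⟨by linarith [hx.2], by linarith [hx.1]⟩
  simpa using this

/-- The slope field with the second variable clamped to `[m, M]`. -/
noncomputable def clampedSlope (m M α x y : ℝ) : ℝ := slopeField α x (max m (min y M))

theorem clampedSlope_eq {m M α x y : ℝ} (h : y ∈ Icc m M) :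
    clampedSlope m M α x y = slopeField α x y := by
  rw [clampedSlope, min_eq_left h.2, max_eq_right h.1]

theorem abs_slopeField_sub_le {α m M R x y₁ y₂ : ℝ} (hm : 0 < m) (hx : |x| ≤ R)
    (h₁ : y₁ ∈ Icc m M) (h₂ : y₂ ∈ Icc m M) :
    |slopeField α x y₁ - slopeField α x y₂| ≤ (2 * M + R ^ 3 / m ^ 2) * |y₁ - y₂| := by
  have hR : 0 ≤ R := (abs_nonneg x).trans hx
  have p₁ : 0 < y₁ := hm.trans_le h₁.1
  have p₂ : 0 < y₂ := hm.trans_le h₂.1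
  have e : slopeField α x y₁ - slopeField α x y₂
      = ((y₁ + y₂) + x ^ 3 / (y₁ * y₂)) * (y₁ - y₂) := by
    unfold slopeField; field_simp; ring
  rw [e, abs_mul]
  gcongr
  refine (abs_add_le _ _).trans (add_le_add ?_ ?_)
  · rw [abs_of_pos (by positivity)]; linarith [h₁.2, h₂.2]
  · rw [abs_div, abs_pow, abs_of_pos (mul_pos p₁ p₂), sq m]
    have := h₁.1
    have := h₂.1
    gcongr

theorem clamp_mem {m M : ℝ} (h : m ≤ M) (y : ℝ) : max m (min y M) ∈ Icc m M :=
  ⟨le_max_left _ _, max_le h (min_le_right _ _)⟩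

theorem abs_clamp_sub_le (m M y₁ y₂ : ℝ) :
    |max m (min y₁ M) - max m (min y₂ M)| ≤ |y₁ - y₂| := by
  refine (abs_max_sub_max_le_max _ _ _ _).trans ?_
  rw [sub_self, abs_zero, max_eq_right (abs_nonneg _)]
  refine (abs_min_sub_min_le_max _ _ _ _).trans ?_
  simp

theorem abs_clampedSlope_sub_le {α m M R x : ℝ} (hm : 0 < m) (hmM : m ≤ M) (hx : |x| ≤ R)
    (y₁ y₂ : ℝ) :
    |clampedSlope m M α x y₁ - clampedSlope m M α x y₂|
      ≤ (2 * M + R ^ 3 / m ^ 2) * |y₁ - y₂| := by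
  have : 0 ≤ R := (abs_nonneg x).trans hx
  have : 0 < M := hm.trans_le hmM
  refine (abs_slopeField_sub_le hm hx (clamp_mem hmM y₁) (clamp_mem hmM y₂)).trans ?_
  exact mul_le_mul_of_nonneg_left (abs_clamp_sub_le _ _ _ _) (by positivity)

theorem abs_slopeField_le {α m M R x y : ℝ} (hm : 0 < m) (hx : |x| ≤ R) (h : y ∈ Icc m M) :
    |slopeField α x y| ≤ M ^ 2 + |α| * R ^ 2 + R ^ 3 / m := by
  have hR : 0 ≤ R := (abs_nonneg x).trans hx
  have p : 0 < y := hm.trans_le h.1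
  unfold slopeField
  refine (abs_sub _ _).trans (add_le_add ((abs_add_le _ _).trans (add_le_add ?_ ?_)) ?_)
  · rw [abs_of_nonneg (sq_nonneg y)]; have := h.2; gcongr
  · rw [abs_mul, abs_pow]; gcongr
  · rw [abs_div, abs_pow, abs_of_pos p]; have := h.1; gcongr

theorem exists_clamped_solution {m M : ℝ} (hm : 0 < m) (hmM : m ≤ M) (α y₀ : ℝ) {N : ℝ}
    (hN : 0 ≤ N) :
    ∃ y : ℝ → ℝ, y (-N) = y₀ ∧ ∀ x ∈ Icc (-N) N,
      HasDerivWithinAt y (clampedSlope m M α x (y x)) (Icc (-N) N) x := by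
  have hM : 0 < M := hm.trans_le hmM
  let L : NNReal := ⟨M ^ 2 + |α| * N ^ 2 + N ^ 3 / m, by positivity⟩
  let K : NNReal := ⟨2 * M + N ^ 3 / m ^ 2, by positivity⟩
  let N' : NNReal := ⟨2 * N, by positivity⟩
  have hPL : IsPicardLindelof (clampedSlope m M α) (tmin := -N) (tmax := N)
      ⟨-N, by constructor <;> linarith⟩ y₀ (L * N') 0 L K := by
    refine ⟨fun t ht => ?_, fun x _ => ?_, fun t ht x _ => ?_, ?_⟩
    · refine LipschitzOnWith.of_dist_le_mul fun u _ w _ => ?_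
      exact abs_clampedSlope_sub_le hm hmM (abs_le.2 ht) u w
    · unfold clampedSlope slopeField; fun_prop
    · exact abs_slopeField_le hm (abs_le.2 ht) (clamp_mem hmM x)
    · have : max (N - -N) (-N - -N) = 2 * N := by rw [max_eq_left] <;> linarith
      simp only [this, NNReal.coe_mul, NNReal.coe_zero, sub_zero]
      exact le_rfl
  exact hPL.exists_eq_forall_mem_Icc_hasDerivWithinAt₀

theorem clampedSlope_sub_param (m M α β x y : ℝ) :
    clampedSlope m M α x y - clampedSlope m M β x y = (α - β) * x ^ 2 := by
  unfold clampedSlope slopeField; ring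

theorem continuous_clamped_solution {m M : ℝ} (hm : 0 < m) (hmM : m ≤ M) {y₀ N : ℝ} (hN : 0 ≤ N)
    {Y : ℝ → ℝ → ℝ} (h₀ : ∀ α, Y α (-N) = y₀)
    (hY : ∀ α, ∀ x ∈ Icc (-N) N,
      HasDerivWithinAt (Y α) (clampedSlope m M α x (Y α x)) (Icc (-N) N) x) :
    Continuous fun α => Y α N := by
  have hM : 0 < M := hm.trans_le hmM
  let K : NNReal := ⟨2 * M + N ^ 3 / m ^ 2, by positivity⟩
  have key : ∀ α β, dist (Y β N) (Y α N) ≤ gronwallBound 0 K (|β - α| * N ^ 2) (N - -N) := by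
    intro α β
    have hIci : ∀ γ, ∀ t ∈ Ico (-N) N,
        HasDerivWithinAt (Y γ) (clampedSlope m M γ t (Y γ t)) (Ici t) t := fun γ t ht =>
      (hY γ t (Ico_subset_Icc_self ht)).mono_of_mem_nhdsWithin (Icc_mem_nhdsGE_of_mem ht)
    have hcont : ∀ γ, ContinuousOn (Y γ) (Icc (-N) N) := fun γ t ht =>
      (hY γ t ht).continuousWithinAt
    have := dist_le_of_approx_trajectories_ODE_of_mem (v := clampedSlope m M α) (K := K)
      (s := fun _ => univ) (f := Y β) (g := Y α) (a := -N) (b := N) (δ := 0)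
      (εf := |β - α| * N ^ 2) (εg := 0)
      (fun t ht => LipschitzOnWith.of_dist_le_mul fun u _ w _ =>
        abs_clampedSlope_sub_le hm hmM (abs_le.2 (Ico_subset_Icc_self ht)) u w)
      (hcont β) (hIci β) (fun t ht => ?_) (fun _ _ => trivial) (hcont α) (hIci α)
      (fun t _ => (dist_self _).le) (fun _ _ => trivial) (by rw [h₀, h₀, dist_self])
      N ⟨by linarith, le_rfl⟩
    · simpa using this
    · rw [Real.dist_eq, clampedSlope_sub_param, abs_mul, abs_of_nonneg (sq_nonneg t)]
      gcongr ?_ * ?_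
      exact sq_le_sq' ht.1 ht.2.le
  refine continuous_iff_continuousAt.2 fun α => tendsto_iff_dist_tendsto_zero.2 ?_
  refine squeeze_zero (fun _ => dist_nonneg) (fun β => key α β) ?_
  have hc : Continuous fun β : ℝ => gronwallBound 0 K (|β - α| * N ^ 2) (N - -N) :=
    (gronwallBound_continuous_ε _ _ _).comp (by fun_prop)
  simpa [gronwallBound_ε0_δ0] using hc.tendsto α

/-- The branch above the axis of a hyperbola with asymptotic slopes `-p` and `r`. -/
noncomputable def conicBranch (p r k x : ℝ) : ℝ :=
  ((r - p) * x + √((p + r) ^ 2 * x ^ 2 + 4 * k)) / 2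

section ConicBranch

variable {p r k : ℝ}

theorem conicBranch_factors (hk : 0 < k) (x : ℝ) :
    0 < conicBranch p r k x - r * x ∧ 0 < conicBranch p r k x + p * x ∧
      (conicBranch p r k x - r * x) * (conicBranch p r k x + p * x) = k := by
  have h0 : 0 < (p + r) ^ 2 * x ^ 2 + 4 * k := by positivity
  have hs := Real.sq_sqrt h0.le
  have hlt : |(p + r) * x| < √((p + r) ^ 2 * x ^ 2 + 4 * k) := by
    rw [← Real.sqrt_sq_eq_abs]
    exact Real.sqrt_lt_sqrt (sq_nonneg _) (by nlinarith)
  have h1 := abs_lt.1 hlt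
  unfold conicBranch
  refine ⟨by linarith [h1.2], by linarith [h1.1], by linear_combination hs / 4⟩

theorem hasDerivAt_conicBranch (hk : 0 < k) (x : ℝ) :
    HasDerivAt (conicBranch p r k)
      ((r * (conicBranch p r k x + p * x) - p * (conicBranch p r k x - r * x)) /
        ((conicBranch p r k x - r * x) + (conicBranch p r k x + p * x))) x := by
  have h0 : 0 < (p + r) ^ 2 * x ^ 2 + 4 * k := by positivity
  have hs := Real.sqrt_pos.2 h0
  have h := (((hasDerivAt_id x).const_mul (r - p)).add
    ((((((hasDerivAt_id x).pow 2).const_mul ((p + r) ^ 2)).add_const (4 * k)).sqrt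
      h0.ne'))).div_const 2
  refine h.congr_deriv ?_
  simp only [conicBranch, Pi.pow_apply, id]
  have e : ((r - p) * x + √((p + r) ^ 2 * x ^ 2 + 4 * k)) / 2 - r * x +
      (((r - p) * x + √((p + r) ^ 2 * x ^ 2 + 4 * k)) / 2 + p * x) =
      √((p + r) ^ 2 * x ^ 2 + 4 * k) := by ring
  rw [e]
  field_simp
  ring

end ConicBranch

theorem slopeField_lt_div {α x B P S m k : ℝ} (hB : 0 < B) (hP : 0 < P) (hS : 0 < S)
    (hk : P * S = k)
    (h : k * ((B ^ 3 + α * x ^ 2 * B - x ^ 3) * (P + S)) < B * m * (P * S)) :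
    slopeField α x B < m / (P + S) := by
  have hk0 : 0 < k := hk ▸ mul_pos hP hS
  have e : slopeField α x B = (B ^ 3 + α * x ^ 2 * B - x ^ 3) / B := by
    unfold slopeField; field_simp
  rw [e, div_lt_div_iff₀ hB (by positivity)]
  rw [hk] at h
  nlinarith

theorem div_lt_slopeField {α x B P S m k : ℝ} (hB : 0 < B) (hP : 0 < P) (hS : 0 < S)
    (hk : P * S = k)
    (h : B * m * (P * S) < k * ((B ^ 3 + α * x ^ 2 * B - x ^ 3) * (P + S))) :
    m / (P + S) < slopeField α x B := by
  have hk0 : 0 < k := hk ▸ mul_pos hP hS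
  have e : slopeField α x B = (B ^ 3 + α * x ^ 2 * B - x ^ 3) / B := by
    unfold slopeField; field_simp
  rw [e, div_lt_div_iff₀ (by positivity) hB]
  rw [hk] at h
  nlinarith

theorem slopeField_conicBranch_lo_left {x : ℝ} (hx : x ≤ 0) :
    slopeField (-19 / 8) x (conicBranch (49 / 100) (11 / 4) (3 / 5) x) <
      (11 / 4 * (conicBranch (49 / 100) (11 / 4) (3 / 5) x + 49 / 100 * x) -
        49 / 100 * (conicBranch (49 / 100) (11 / 4) (3 / 5) x - 11 / 4 * x)) /
        ((conicBranch (49 / 100) (11 / 4) (3 / 5) x - 11 / 4 * x) +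
          (conicBranch (49 / 100) (11 / 4) (3 / 5) x + 49 / 100 * x)) := by
  obtain ⟨hP, hS, hk⟩ := conicBranch_factors (p := 49 / 100) (r := 11 / 4) (k := 3 / 5)
    (by norm_num) x
  generalize conicBranch (49 / 100) (11 / 4) (3 / 5) x = B at *
  refine slopeField_lt_div (by linarith) hP hS hk ?_
  obtain ⟨s, rfl⟩ : ∃ s, x = -s := ⟨-x, by simp⟩
  obtain ⟨d, rfl⟩ : ∃ d, B = 49 / 100 * s + d := ⟨B - 49 / 100 * s, by ring⟩
  have hd : 0 < d := by linarith
  have hs : 0 ≤ s := by linarith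
  have : 0 ≤ s * d := by positivity
  nlinarith [sq_nonneg (s ^ 2 + 4 * s * d - 8 * d ^ 2),
    mul_nonneg this (sq_nonneg (s - 2 * d)), mul_nonneg this (sq_nonneg (s - 3 / 2 * d)),
    pow_pos hd 4, pow_nonneg hs 4, mul_nonneg this (sq_nonneg (s - 5 / 2 * d))]

theorem slopeField_conicBranch_lo_right {x : ℝ} (hx : 0 ≤ x) :
    slopeField (-19 / 8) x (conicBranch 0 (3 / 2) (3 / 5) x) <
      (3 / 2 * (conicBranch 0 (3 / 2) (3 / 5) x + 0 * x) -
        0 * (conicBranch 0 (3 / 2) (3 / 5) x - 3 / 2 * x)) /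
        ((conicBranch 0 (3 / 2) (3 / 5) x - 3 / 2 * x) +
          (conicBranch 0 (3 / 2) (3 / 5) x + 0 * x)) := by
  obtain ⟨hP, hS, hk⟩ := conicBranch_factors (p := 0) (r := 3 / 2) (k := 3 / 5)
    (by norm_num) x
  generalize conicBranch 0 (3 / 2) (3 / 5) x = B at *
  refine slopeField_lt_div (by linarith) hP hS hk ?_
  obtain ⟨d, rfl⟩ : ∃ d, B = 3 / 2 * x + d := ⟨B - 3 / 2 * x, by ring⟩
  have hd : 0 < d := by linarith
  rw [← sub_pos]
  have : 0 < 171 / 160 * x ^ 4 + 51 / 20 * x ^ 3 * d + 33 / 40 * x ^ 2 * d ^ 2 +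
    9 / 20 * x * d ^ 3 + 3 / 10 * d ^ 4 := by positivity
  linarith

theorem slopeField_conicBranch_hi_left {x : ℝ} (hx : x ≤ 0) :
    (41 / 20 * (conicBranch (12 / 25) (41 / 20) (4 / 5) x + 12 / 25 * x) -
        12 / 25 * (conicBranch (12 / 25) (41 / 20) (4 / 5) x - 41 / 20 * x)) /
        ((conicBranch (12 / 25) (41 / 20) (4 / 5) x - 41 / 20 * x) +
          (conicBranch (12 / 25) (41 / 20) (4 / 5) x + 12 / 25 * x)) <
    slopeField (-529 / 250) x (conicBranch (12 / 25) (41 / 20) (4 / 5) x) := by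
  obtain ⟨hP, hS, hk⟩ := conicBranch_factors (p := 12 / 25) (r := 41 / 20) (k := 4 / 5)
    (by norm_num) x
  generalize conicBranch (12 / 25) (41 / 20) (4 / 5) x = B at *
  refine div_lt_slopeField (by linarith) hP hS hk ?_
  obtain ⟨s, rfl⟩ : ∃ s, x = -s := ⟨-x, by simp⟩
  obtain ⟨d, rfl⟩ : ∃ d, B = 12 / 25 * s + d := ⟨B - 12 / 25 * s, by ring⟩
  have hd : 0 < d := by linarith
  have hs : 0 ≤ s := by linarith
  have : 0 ≤ s * d := by positivity
  nlinarith [sq_nonneg (s * (s - 13 / 4 * d)), sq_nonneg (s * (s - 3 * d)),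
    mul_nonneg this (sq_nonneg d), sq_nonneg (s ^ 2 - 13 / 4 * s * d - d ^ 2),
    pow_pos hd 4, pow_nonneg hs 4]

theorem slopeField_conicBranch_hi_right {x : ℝ} (hx : 0 ≤ x) :
    (17 / 10 * (conicBranch (1 / 5) (17 / 10) (4 / 5) x + 1 / 5 * x) -
        1 / 5 * (conicBranch (1 / 5) (17 / 10) (4 / 5) x - 17 / 10 * x)) /
        ((conicBranch (1 / 5) (17 / 10) (4 / 5) x - 17 / 10 * x) +
          (conicBranch (1 / 5) (17 / 10) (4 / 5) x + 1 / 5 * x)) <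
    slopeField (-529 / 250) x (conicBranch (1 / 5) (17 / 10) (4 / 5) x) := by
  obtain ⟨hP, hS, hk⟩ := conicBranch_factors (p := 1 / 5) (r := 17 / 10) (k := 4 / 5)
    (by norm_num) x
  generalize conicBranch (1 / 5) (17 / 10) (4 / 5) x = B at *
  refine div_lt_slopeField (by linarith) hP hS hk ?_
  obtain ⟨d, rfl⟩ : ∃ d, B = 17 / 10 * x + d := ⟨B - 17 / 10 * x, by ring⟩
  have hd : 0 < d := by linarith
  rw [← sub_pos]
  have : 0 < 30001 / 62500 * x ^ 4 + 1723 / 50000 * x ^ 3 * d + 8827 / 5000 * x ^ 2 * d ^ 2 +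
    21 / 20 * x * d ^ 3 + 1 / 10 * d ^ 4 := by positivity
  linarith

/-- Solutions of the clamped slope equation on `[-N, N]` issuing from `(-N, 97/200 * N)`. -/
structure IsClampedSolution (N α : ℝ) (y : ℝ → ℝ) : Prop where
  left_end : y (-N) = 97 / 200 * N
  deriv : ∀ x ∈ Icc (-N) N,
    HasDerivWithinAt y (clampedSlope (1 / 20) (2 + 2 * N) α x (y x)) (Icc (-N) N) x

theorem slopeField_lt_of_cubic_lt {α x U c : ℝ} (hU : 0 < U)
    (h : U ^ 3 + α * x ^ 2 * U - x ^ 3 < c * U) : slopeField α x U < c := by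
  have e : slopeField α x U = (U ^ 3 + α * x ^ 2 * U - x ^ 3) / U := by
    unfold slopeField; field_simp
  rwa [e, div_lt_iff₀ hU]

theorem lt_slopeField_of_lt_cubic {α x U c : ℝ} (hU : 0 < U)
    (h : c * U < U ^ 3 + α * x ^ 2 * U - x ^ 3) : c < slopeField α x U := by
  have e : slopeField α x U = (U ^ 3 + α * x ^ 2 * U - x ^ 3) / U := by
    unfold slopeField; field_simp
  rwa [e, lt_div_iff₀ hU]

theorem conicBranch_zero (p r k : ℝ) : conicBranch p r k 0 = √(4 * k) / 2 := by
  simp [conicBranch]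

theorem hasDerivAt_line (b c x : ℝ) : HasDerivAt (fun x => b + c * x) c x := by
  simpa using ((hasDerivAt_id x).const_mul c).const_add b

namespace IsClampedSolution

variable {N α : ℝ} {y : ℝ → ℝ}

theorem deriv_on (h : IsClampedSolution N α y) {a b : ℝ} (ha : -N ≤ a) (hb : b ≤ N) :
    ∀ x ∈ Icc a b, HasDerivWithinAt y (clampedSlope (1 / 20) (2 + 2 * N) α x (y x)) (Icc a b) x :=
  fun x hx => (h.deriv x ⟨ha.trans hx.1, hx.2.trans hb⟩).mono (Icc_subset_Icc ha hb)

theorem right_end_le (h : IsClampedSolution N (-19 / 8) y) (hN : 10 ≤ N) : y N ≤ 8 / 5 * N := by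
  have hl : ∀ x ∈ Icc (-N) 0, y x ≤ conicBranch (49 / 100) (11 / 4) (3 / 5) x := by
    refine image_le_of_deriv_lt_of_left (h.deriv_on le_rfl (by linarith))
      (fun x _ => (hasDerivAt_conicBranch (by norm_num) x).hasDerivWithinAt) ?_ fun x hx e => ?_
    · rw [h.left_end]
      obtain ⟨-, hS, -⟩ := conicBranch_factors (p := 49 / 100) (r := 11 / 4) (k := 3 / 5)
        (by norm_num) (-N)
      linarith
    · have hlt := slopeField_conicBranch_lo_left hx.2
      obtain ⟨hP, hS, hk⟩ := conicBranch_factors (p := 49 / 100) (r := 11 / 4) (k := 3 / 5)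
        (by norm_num) x
      have hx1 := hx.1
      have hx2 := hx.2
      rw [e, clampedSlope_eq]
      · exact hlt
      · constructor <;> by_contra! hcon <;> nlinarith
  have hr : ∀ x ∈ Icc 0 N, y x ≤ conicBranch 0 (3 / 2) (3 / 5) x := by
    refine image_le_of_deriv_lt_of_left (h.deriv_on (by linarith) le_rfl)
      (fun x _ => (hasDerivAt_conicBranch (by norm_num) x).hasDerivWithinAt) ?_ fun x hx e => ?_
    · have := hl 0 ⟨by linarith, le_rfl⟩
      rwa [conicBranch_zero] at this ⊢
    · have hlt := slopeField_conicBranch_lo_right hx.1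
      obtain ⟨hP, hS, hk⟩ := conicBranch_factors (p := 0) (r := 3 / 2) (k := 3 / 5)
        (by norm_num) x
      have hx1 := hx.1
      have hx2 := hx.2
      rw [e, clampedSlope_eq]
      · exact hlt
      · constructor <;> by_contra! hcon <;> nlinarith
  refine (hr N ⟨by linarith, le_rfl⟩).trans ?_
  obtain ⟨hP, hS, hk⟩ := conicBranch_factors (p := 0) (r := 3 / 2) (k := 3 / 5)
    (by norm_num) N
  by_contra! hcon
  nlinarith

theorem le_right_end (h : IsClampedSolution N (-529 / 250) y) (hN : 10 ≤ N) :
    8 / 5 * N ≤ y N := by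
  have hl : ∀ x ∈ Icc (-N) 0, conicBranch (12 / 25) (41 / 20) (4 / 5) x ≤ y x := by
    refine image_le_of_deriv_lt_of_left
      (fun x _ => (hasDerivAt_conicBranch (by norm_num) x).hasDerivWithinAt)
      (h.deriv_on le_rfl (by linarith)) ?_ fun x hx e => ?_
    · rw [h.left_end]
      obtain ⟨hP, hS, hk⟩ := conicBranch_factors (p := 12 / 25) (r := 41 / 20) (k := 4 / 5)
        (by norm_num) (-N)
      by_contra! hcon
      nlinarith
    · have hlt := slopeField_conicBranch_hi_left hx.2
      obtain ⟨hP, hS, hk⟩ := conicBranch_factors (p := 12 / 25) (r := 41 / 20) (k := 4 / 5)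
        (by norm_num) x
      have hx1 := hx.1
      have hx2 := hx.2
      rw [← e, clampedSlope_eq]
      · exact hlt
      · constructor <;> by_contra! hcon <;> nlinarith
  have hr : ∀ x ∈ Icc 0 N, conicBranch (1 / 5) (17 / 10) (4 / 5) x ≤ y x := by
    refine image_le_of_deriv_lt_of_left
      (fun x _ => (hasDerivAt_conicBranch (by norm_num) x).hasDerivWithinAt)
      (h.deriv_on (by linarith) le_rfl) ?_ fun x hx e => ?_
    · have := hl 0 ⟨by linarith, le_rfl⟩
      rwa [conicBranch_zero] at this ⊢
    · have hlt := slopeField_conicBranch_hi_right hx.1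
      obtain ⟨hP, hS, hk⟩ := conicBranch_factors (p := 1 / 5) (r := 17 / 10) (k := 4 / 5)
        (by norm_num) x
      have hx1 := hx.1
      have hx2 := hx.2
      rw [← e, clampedSlope_eq]
      · exact hlt
      · constructor <;> by_contra! hcon <;> nlinarith
  refine le_trans ?_ (hr N ⟨by linarith, le_rfl⟩)
  obtain ⟨hP, -, -⟩ := conicBranch_factors (p := 1 / 5) (r := 17 / 10) (k := 4 / 5)
    (by norm_num) N
  linarith

theorem left_lower (h : IsClampedSolution N α y) (hN : 10 ≤ N) (hα : -19 / 8 ≤ α) :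
    ∀ x ∈ Icc (-N) 0, 1 / 20 + -9 / 20 * x ≤ y x := by
  refine image_le_of_deriv_lt_of_left (fun x _ => (hasDerivAt_line _ _ x).hasDerivWithinAt)
    (h.deriv_on le_rfl (by linarith)) ?_ fun x hx e => ?_
  · rw [h.left_end]; linarith
  · have hx1 := hx.1
    have hx2 := hx.2
    rw [← e, clampedSlope_eq ⟨by linarith, by linarith⟩]
    refine lt_slopeField_of_lt_cubic (by linarith) ?_
    have : (-19 / 8) * (x ^ 2 * (1 / 20 + -9 / 20 * x)) ≤ α * (x ^ 2 * (1 / 20 + -9 / 20 * x)) :=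
      mul_le_mul_of_nonneg_right hα (mul_nonneg (sq_nonneg x) (by linarith))
    nlinarith [mul_nonneg (neg_nonneg.2 hx2) (sq_nonneg (x + 2)), sq_nonneg x]

theorem right_lower (h : IsClampedSolution N α y) (hN : 10 ≤ N) (hα : α ≤ -529 / 250)
    (hend : y N = 8 / 5 * N) : ∀ x ∈ Icc 0 N, 1 / 20 + 3 / 2 * x ≤ y x := by
  refine image_le_of_deriv_lt_of_right (fun x _ => (hasDerivAt_line _ _ x).hasDerivWithinAt)
    (h.deriv_on (by linarith) le_rfl) ?_ fun x hx e => ?_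
  · rw [hend]; linarith
  · have hx1 := hx.1
    have hx2 := hx.2
    rw [← e, clampedSlope_eq ⟨by linarith, by linarith⟩]
    refine slopeField_lt_of_cubic_lt (by linarith) ?_
    have : α * (x ^ 2 * (1 / 20 + 3 / 2 * x)) ≤ (-529 / 250) * (x ^ 2 * (1 / 20 + 3 / 2 * x)) :=
      mul_le_mul_of_nonneg_right hα (mul_nonneg (sq_nonneg x) (by linarith))
    nlinarith [mul_nonneg hx1 (sq_nonneg (x - 1)), sq_nonneg x]

theorem right_upper (h : IsClampedSolution N α y) (hN : 10 ≤ N) (hα : -19 / 8 ≤ α)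
    (hend : y N = 8 / 5 * N) : ∀ x ∈ Icc 0 N, y x ≤ 2 + 2 * x := by
  refine image_le_of_deriv_lt_of_right (h.deriv_on (by linarith) le_rfl)
    (fun x _ => (hasDerivAt_line _ _ x).hasDerivWithinAt) ?_ fun x hx e => ?_
  · rw [hend]; linarith
  · have hx1 := hx.1
    have hx2 := hx.2
    rw [e, clampedSlope_eq ⟨by linarith, by linarith⟩]
    refine lt_slopeField_of_lt_cubic (by linarith) ?_
    have : (-19 / 8) * (x ^ 2 * (2 + 2 * x)) ≤ α * (x ^ 2 * (2 + 2 * x)) :=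
      mul_le_mul_of_nonneg_right hα (mul_nonneg (sq_nonneg x) (by linarith))
    nlinarith [pow_nonneg hx1 3, sq_nonneg x]

theorem left_upper (h : IsClampedSolution N α y) (hN : 10 ≤ N) (hα : -19 / 8 ≤ α)
    (h0 : y 0 ≤ 2) : ∀ x ∈ Icc (-N) 0, y x ≤ 2 + -2 * x := by
  refine image_le_of_deriv_lt_of_right (h.deriv_on le_rfl (by linarith))
    (fun x _ => (hasDerivAt_line _ _ x).hasDerivWithinAt) (by simpa using h0) fun x hx e => ?_
  have hx1 := hx.1
  have hx2 := hx.2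
  rw [e, clampedSlope_eq ⟨by linarith, by linarith⟩]
  refine lt_slopeField_of_lt_cubic (by linarith) ?_
  have : (-19 / 8) * (x ^ 2 * (2 + -2 * x)) ≤ α * (x ^ 2 * (2 + -2 * x)) :=
    mul_le_mul_of_nonneg_right hα (mul_nonneg (sq_nonneg x) (by linarith))
  nlinarith [pow_nonneg (neg_nonneg.2 hx2) 3, sq_nonneg x]

theorem left_sector (h : IsClampedSolution N α y) (hN : 10 ≤ N) (hα : α ≤ -529 / 250) :
    ∀ x ∈ Icc (-N) (-4), y x ≤ 1 + -3 / 4 * x := by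
  refine image_le_of_deriv_lt_of_left (h.deriv_on le_rfl (by linarith))
    (fun x _ => (hasDerivAt_line _ _ x).hasDerivWithinAt) ?_ fun x hx e => ?_
  · rw [h.left_end]; linarith
  · have hx1 := hx.1
    have hx2 := hx.2
    rw [e, clampedSlope_eq ⟨by linarith, by linarith⟩]
    refine slopeField_lt_of_cubic_lt (by linarith) ?_
    have : α * (x ^ 2 * (1 + -3 / 4 * x)) ≤ (-529 / 250) * (x ^ 2 * (1 + -3 / 4 * x)) :=
      mul_le_mul_of_nonneg_right hα (mul_nonneg (sq_nonneg x) (by linarith))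
    obtain ⟨t, rfl⟩ : ∃ t, x = -4 - t := ⟨-4 - x, by ring⟩
    have ht : 0 ≤ t := by linarith
    nlinarith [pow_nonneg ht 3, sq_nonneg t]

end IsClampedSolution

/-- The estimates shared by the approximating graphs and inherited by their limit. -/
structure GraphBounds (x y : ℝ) : Prop where
  lower : 1 / 20 + 9 / 20 * |x| ≤ y
  upper : y ≤ 2 + 2 * |x|
  right_lower : 0 ≤ x → 1 / 20 + 3 / 2 * x ≤ y
  left_sector : x ≤ -4 → y ≤ 1 + -3 / 4 * x

theorem exists_graph_on_Icc {N : ℝ} (hN : 10 ≤ N) :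
    ∃ α ∈ Icc (-19 / 8 : ℝ) (-529 / 250), ∃ y : ℝ → ℝ, ∀ x ∈ Icc (-N) N,
      HasDerivWithinAt y (slopeField α x (y x)) (Icc (-N) N) x ∧ GraphBounds x (y x) := by
  have hm : (0 : ℝ) < 1 / 20 := by norm_num
  have hmM : (1 / 20 : ℝ) ≤ 2 + 2 * N := by linarith
  have hN0 : 0 ≤ N := by linarith
  choose Y hY₀ hY using fun α => exists_clamped_solution hm hmM α (97 / 200 * N) hN0
  have hsol : ∀ α, IsClampedSolution N α (Y α) := fun α => ⟨hY₀ α, hY α⟩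
  have hc := continuous_clamped_solution hm hmM hN0 hY₀ hY
  obtain ⟨α, hα, hend⟩ := intermediate_value_Icc (by norm_num : (-19 / 8 : ℝ) ≤ -529 / 250)
    hc.continuousOn ⟨(hsol _).right_end_le hN, (hsol _).le_right_end hN⟩
  have h := hsol α
  have hll := h.left_lower hN hα.1
  have hrl := h.right_lower hN hα.2 hend
  have hru := h.right_upper hN hα.1 hend
  have hlu := h.left_upper hN hα.1 (by simpa using hru 0 ⟨le_rfl, hN0⟩)
  have hls := h.left_sector hN hα.2
  refine ⟨α, hα, Y α, fun x hx => ?_⟩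
  have hb : GraphBounds x (Y α x) := by
    rcases le_total x 0 with h0 | h0
    · have h1 := hll x ⟨hx.1, h0⟩
      have h2 := hlu x ⟨hx.1, h0⟩
      refine ⟨by rw [abs_of_nonpos h0]; linarith, by rw [abs_of_nonpos h0]; linarith,
        fun h => by linarith, fun h => hls x ⟨hx.1, h⟩⟩
    · have h1 := hrl x ⟨h0, hx.2⟩
      have h2 := hru x ⟨h0, hx.2⟩
      exact ⟨by rw [abs_of_nonneg h0]; linarith, by rw [abs_of_nonneg h0]; linarith,
        fun _ => h1, fun h => by linarith⟩
  have hd := h.deriv x hx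
  rw [clampedSlope_eq ⟨by linarith [hb.lower, abs_nonneg x], by
    linarith [hb.upper, abs_le.2 hx]⟩] at hd
  exact ⟨hd, hb⟩

theorem abs_slopeField_sub_le_left {α R m x₁ x₂ y : ℝ} (hm : 0 < m) (hα : |α| ≤ 3)
    (h₁ : |x₁| ≤ R) (h₂ : |x₂| ≤ R) (hy : m ≤ y) :
    |slopeField α x₁ y - slopeField α x₂ y| ≤ (6 * R + 3 * R ^ 2 / m) * |x₁ - x₂| := by
  have hR : 0 ≤ R := (abs_nonneg _).trans h₁
  have p : 0 < y := hm.trans_le hy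
  have e : slopeField α x₁ y - slopeField α x₂ y
      = (α * (x₁ + x₂) - (x₁ ^ 2 + x₁ * x₂ + x₂ ^ 2) / y) * (x₁ - x₂) := by
    unfold slopeField; field_simp; ring
  rw [e, abs_mul]
  refine mul_le_mul_of_nonneg_right ((abs_sub _ _).trans (add_le_add ?_ ?_)) (abs_nonneg _)
  · rw [abs_mul]
    calc |α| * |x₁ + x₂| ≤ 3 * (R + R) := by
          gcongr; exact (abs_add_le _ _).trans (add_le_add h₁ h₂)
      _ = 6 * R := by ring
  · rw [abs_div, abs_of_pos p]
    gcongr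
    have h3 : |x₁ * x₂| ≤ R ^ 2 := by rw [abs_mul, sq]; gcongr
    have h1 : |x₁ ^ 2| ≤ R ^ 2 := by rw [abs_pow]; gcongr
    have h2 : |x₂ ^ 2| ≤ R ^ 2 := by rw [abs_pow]; gcongr
    linarith [abs_add_le (x₁ ^ 2 + x₁ * x₂) (x₂ ^ 2), abs_add_le (x₁ ^ 2) (x₁ * x₂)]

theorem abs_taylor_remainder_le {α R m M : ℝ} {y : ℝ → ℝ} (hm : 0 < m) (hα : |α| ≤ 3)
    (hy : ∀ x ∈ Icc (-R) R,
      HasDerivWithinAt y (slopeField α x (y x)) (Icc (-R) R) x ∧ y x ∈ Icc m M)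
    {x₀ x : ℝ} (hx₀ : x₀ ∈ Icc (-R) R) (hx : x ∈ Icc (-R) R) :
    |y x - y x₀ - (x - x₀) * slopeField α x₀ (y x₀)| ≤
      ((2 * M + R ^ 3 / m ^ 2) * (M ^ 2 + 3 * R ^ 2 + R ^ 3 / m) + (6 * R + 3 * R ^ 2 / m)) *
        |x - x₀| * |x - x₀| := by
  have hR : 0 ≤ R := by linarith [hx.1, hx.2]
  have hM : 0 ≤ M := hm.le.trans ((hy x hx).2.1.trans (hy x hx).2.2)
  have hsub : uIcc x₀ x ⊆ Icc (-R) R := uIcc_subset_Icc hx₀ hx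
  have hlip : ∀ t ∈ Icc (-R) R, |y t - y x₀| ≤ (M ^ 2 + 3 * R ^ 2 + R ^ 3 / m) * |t - x₀| := by
    intro t ht
    refine (convex_Icc (-R) R).norm_image_sub_le_of_norm_hasDerivWithin_le
      (fun u hu => (hy u hu).1) (fun u hu => ?_) hx₀ ht
    refine (abs_slopeField_le hm (abs_le.2 hu) (hy u hu).2).trans ?_
    gcongr
  have key := (convex_uIcc x₀ x).norm_image_sub_le_of_norm_hasDerivWithin_le
    (f := fun t => y t - t * slopeField α x₀ (y x₀))
    (f' := fun t => slopeField α t (y t) - slopeField α x₀ (y x₀))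
    (C := ((2 * M + R ^ 3 / m ^ 2) * (M ^ 2 + 3 * R ^ 2 + R ^ 3 / m) +
      (6 * R + 3 * R ^ 2 / m)) * |x - x₀|)
    (fun t ht => ?_) (fun t ht => ?_) left_mem_uIcc right_mem_uIcc
  · rw [Real.norm_eq_abs, Real.norm_eq_abs] at key
    convert key using 2
    ring
  · have := ((hy t (hsub ht)).1.mono hsub).sub
      (((hasDerivAt_id t).mul_const (slopeField α x₀ (y x₀))).hasDerivWithinAt)
    rw [one_mul] at this
    exact this
  · have ht' := hsub ht
    have hdist : |t - x₀| ≤ |x - x₀| := abs_sub_left_of_mem_uIcc ht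
    have h1 := abs_slopeField_sub_le (α := α) hm (abs_le.2 ht') (hy t ht').2 (hy x₀ hx₀).2
    have h2 := abs_slopeField_sub_le_left hm hα (abs_le.2 ht') (abs_le.2 hx₀) (hy x₀ hx₀).2.1
    rw [Real.norm_eq_abs]
    calc _ ≤ |slopeField α t (y t) - slopeField α t (y x₀)| +
          |slopeField α t (y x₀) - slopeField α x₀ (y x₀)| := abs_sub_le _ _ _
      _ ≤ (2 * M + R ^ 3 / m ^ 2) * ((M ^ 2 + 3 * R ^ 2 + R ^ 3 / m) * |x - x₀|) +
          (6 * R + 3 * R ^ 2 / m) * |x - x₀| := by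
        refine add_le_add (h1.trans ?_) (h2.trans ?_)
        · refine mul_le_mul_of_nonneg_left ((hlip t ht').trans ?_) (by positivity)
          exact mul_le_mul_of_nonneg_left hdist (by positivity)
        · exact mul_le_mul_of_nonneg_left hdist (by positivity)
      _ = _ := by ring

theorem hasDerivAt_of_abs_taylor_le {y : ℝ → ℝ} {x₀ d C : ℝ}
    (h : ∀ᶠ x in 𝓝 x₀, |y x - y x₀ - (x - x₀) * d| ≤ C * |x - x₀| * |x - x₀|) :
    HasDerivAt y d x₀ := by
  rw [hasDerivAt_iff_tendsto]
  refine squeeze_zero' (Eventually.of_forall fun x => by positivity)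
    (h.mono fun x hx => ?_) (g := fun x => C * |x - x₀|) ?_
  · rcases eq_or_ne x x₀ with rfl | hne
    · simp
    · have hpos : 0 < |x - x₀| := abs_pos.2 (sub_ne_zero.2 hne)
      rw [Real.norm_eq_abs, Real.norm_eq_abs, smul_eq_mul, inv_mul_le_iff₀ hpos]
      linarith
  · have : Continuous fun x => C * |x - x₀| := by fun_prop
    simpa using this.tendsto x₀

theorem isClosed_graphBounds (x : ℝ) : IsClosed {y | GraphBounds x y} := by
  have e : {y | GraphBounds x y} = (Icc (1 / 20 + 9 / 20 * |x|) (2 + 2 * |x|) ∩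
      {y | 0 ≤ x → 1 / 20 + 3 / 2 * x ≤ y}) ∩ {y | x ≤ -4 → y ≤ 1 + -3 / 4 * x} := by
    ext y
    exact ⟨fun h => ⟨⟨⟨h.1, h.2⟩, h.3⟩, h.4⟩, fun h => ⟨h.1.1.1, h.1.1.2, h.1.2, h.2⟩⟩
  rw [e]
  refine (isClosed_Icc.inter ?_).inter ?_
  · by_cases h : 0 ≤ x <;> simp [h]
    exact isClosed_Ici
  · by_cases h : x ≤ -4 <;> simp [h]
    exact isClosed_Iic

theorem isCompact_graphBounds (x : ℝ) : IsCompact {y | GraphBounds x y} :=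
  (isCompact_Icc (a := 1 / 20 + 9 / 20 * |x|) (b := 2 + 2 * |x|)).of_isClosed_subset
    (isClosed_graphBounds x) fun _ (h : GraphBounds x _) => ⟨h.lower, h.upper⟩

theorem exists_global_graph :
    ∃ α ∈ Icc (-19 / 8 : ℝ) (-529 / 250), ∃ y : ℝ → ℝ, ∀ x,
      HasDerivAt y (slopeField α x (y x)) x ∧ GraphBounds x (y x) := by
  choose a ha y hy using fun n : ℕ =>
    exists_graph_on_Icc (N := (n : ℝ) + 10) (by linarith [n.cast_nonneg (α := ℝ)])
  let U : Ultrafilter ℕ := hyperfilter ℕ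
  have hU : ∀ R : ℝ, ∀ᶠ n : ℕ in (U : Filter ℕ), R ≤ (n : ℝ) + 10 := by
    intro R
    have h1 : ∀ᶠ n : ℕ in atTop, R ≤ (n : ℝ) + 10 :=
      (tendsto_natCast_atTop_atTop.eventually_ge_atTop R).mono fun n hn => by linarith
    exact Nat.hyperfilter_le_atTop h1
  obtain ⟨α, hα, hα'⟩ := isCompact_Icc.ultrafilter_le_nhds (U.map a)
    (le_principal_iff.2 (Eventually.of_forall (f := (U : Filter ℕ)) ha))
  have hlim : ∀ x, ∃ w ∈ {w | GraphBounds x w}, Tendsto (fun n => y n x) U (𝓝 w) := by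
    intro x
    refine (isCompact_graphBounds x).ultrafilter_le_nhds (U.map fun n => y n x)
      (le_principal_iff.2 ?_)
    exact (hU |x|).mono fun n hn => (hy n x (abs_le.1 hn)).2
  choose w hw hw' using hlim
  replace hw : ∀ x, GraphBounds x (w x) := hw
  have haα : Tendsto a U (𝓝 α) := hα'
  refine ⟨α, hα, w, fun x₀ => ⟨?_, hw x₀⟩⟩
  set R := |x₀| + 1 with hR
  have hpos : 0 < w x₀ := by linarith [(hw x₀).lower, abs_nonneg x₀]
  have hF : Tendsto (fun n => slopeField (a n) x₀ (y n x₀)) U (𝓝 (slopeField α x₀ (w x₀))) :=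
    (((hw' x₀).pow 2).add (haα.mul_const _)).sub (tendsto_const_nhds.div (hw' x₀) hpos.ne')
  have hx₀ : x₀ ∈ Icc (-R) R := abs_le.1 (by linarith)
  have hnhds : Icc (-R) R ∈ 𝓝 x₀ :=
    Icc_mem_nhds (by linarith [neg_abs_le x₀]) (by linarith [le_abs_self x₀])
  refine hasDerivAt_of_abs_taylor_le (C := (2 * (2 + 2 * R) + R ^ 3 / (1 / 20) ^ 2) *
    ((2 + 2 * R) ^ 2 + 3 * R ^ 2 + R ^ 3 / (1 / 20)) + (6 * R + 3 * R ^ 2 / (1 / 20))) ?_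
  filter_upwards [hnhds] with x hx
  refine le_of_tendsto ((((hw' x).sub (hw' x₀)).sub (hF.const_mul (x - x₀))).abs) ?_
  filter_upwards [hU R] with n hn
  have hsub : Icc (-R) R ⊆ Icc (-((n : ℝ) + 10)) (n + 10) :=
    Icc_subset_Icc (neg_le_neg hn) hn
  refine abs_taylor_remainder_le (by norm_num) (abs_le.2 ?_) (fun t ht => ?_) hx₀ hx
  · constructor <;> linarith [(ha n).1, (ha n).2]
  · obtain ⟨h1, h2⟩ := hy n t (hsub ht)
    refine ⟨h1.mono hsub, ?_, ?_⟩
    · linarith [h2.lower, abs_nonneg t]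
    · linarith [h2.upper, abs_le.2 ht]

section Repelling

variable {w g : ℝ → ℝ} {w₀ s₀ δ C : ℝ}

theorem eventually_le_of_repelling (hδ : 0 < δ)
    (hw : ∀ s, s₀ ≤ s → HasDerivAt w (s * ((w s - w₀) * g s) - w s / s) s)
    (hg : ∀ s, s₀ ≤ s → δ ≤ g s) (hC : ∀ s, s₀ ≤ s → |w s| ≤ C) {ε : ℝ} (hε : 0 < ε) :
    ∀ᶠ s in atTop, w s ≤ w₀ + ε := by
  have hC0 : 0 ≤ C := (abs_nonneg _).trans (hC s₀ le_rfl)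
  filter_upwards [eventually_ge_atTop s₀, eventually_ge_atTop 1,
    eventually_ge_atTop ((C + 1) / (ε * δ))] with s h0 h1 h2
  by_contra! hcon
  set T := s + 2 * (C + |w₀| + 1) with hT
  have hsT : s ≤ T := by linarith [abs_nonneg w₀]
  have hline := image_le_of_deriv_lt_of_left (a := s) (b := T)
    (f := fun t => (w₀ + ε - 1 / 2 * s) + 1 / 2 * t) (f' := fun _ => 1 / 2) (g := w)
    (g' := fun t => t * ((w t - w₀) * g t) - w t / t)
    (fun t _ => (hasDerivAt_line _ _ t).hasDerivWithinAt)
    (fun t ht => (hw t (h0.trans ht.1)).hasDerivWithinAt) (by linarith) (fun t ht e => ?_)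
    T ⟨hsT, le_rfl⟩
  · have := (le_abs_self _).trans (hC T (h0.trans hsT))
    linarith [neg_abs_le w₀]
  · have ht1 : 1 ≤ t := h1.trans ht.1
    have hd : ε ≤ w t - w₀ := by linarith [ht.1]
    have hq : w t / t ≤ C := by
      have hCt := (le_abs_self _).trans (hC t (h0.trans ht.1))
      rw [div_le_iff₀ (by linarith)]
      nlinarith
    have hp : C + 1 ≤ t * (ε * δ) := by
      rw [← div_le_iff₀ (by positivity)]
      exact h2.trans ht.1
    have hm : t * (ε * δ) ≤ t * ((w t - w₀) * g t) := by
      have := hg t (h0.trans ht.1)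
      gcongr
      linarith
    linarith

theorem tendsto_of_repelling (hδ : 0 < δ)
    (hw : ∀ s, s₀ ≤ s → HasDerivAt w (s * ((w s - w₀) * g s) - w s / s) s)
    (hg : ∀ s, s₀ ≤ s → δ ≤ g s) (hC : ∀ s, s₀ ≤ s → |w s| ≤ C) :
    Tendsto w atTop (𝓝 w₀) := by
  rw [Metric.tendsto_nhds]
  intro ε hε
  have hneg := eventually_le_of_repelling (w := fun s => -w s) (w₀ := -w₀) hδ
    (fun s hs => (hw s hs).neg.congr_deriv (by ring)) hg (fun s hs => by simpa using hC s hs)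
    (half_pos hε)
  filter_upwards [eventually_le_of_repelling hδ hw hg hC (half_pos hε), hneg] with s h1 h2
  rw [Real.dist_eq, abs_lt]
  constructor <;> linarith

end Repelling

section Asymptotics

variable {α u : ℝ} {y : ℝ → ℝ}

theorem tendsto_div_atTop (hu : 0 < u) (hroot : u ^ 3 + α * u - 1 = 0)
    (hy : ∀ x, HasDerivAt y (slopeField α x (y x)) x ∧ GraphBounds x (y x)) :
    Tendsto (fun x => x / y x) atTop (𝓝 (1 / u)) := by
  have hpos : ∀ x, 0 < y x := fun x => by linarith [(hy x).2.lower, abs_nonneg x]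
  have h : Tendsto (fun x => y x / x) atTop (𝓝 u) := by
    refine tendsto_of_repelling (s₀ := 1) (C := 4) hu
      (g := fun x => y x / x + u + 1 / (u * (y x / x))) (fun x hx => ?_) (fun x hx => ?_)
      fun x hx => ?_
    · have h0 : x ≠ 0 := by linarith
      refine ((hy x).1.div (hasDerivAt_id x) h0).congr_deriv ?_
      have hα : α = 1 / u - u ^ 2 := by field_simp; linarith
      have := (hpos x).ne'
      simp only [slopeField, id, hα]
      field_simp
      ring
    · have h0 : 0 < x := by linarith
      have := hpos x
      have : 0 < y x / x + 1 / (u * (y x / x)) := by positivity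
      linarith
    · have h0 : 0 < x := by linarith
      have := (hy x).2.upper
      rw [abs_of_pos h0] at this
      rw [abs_of_pos (div_pos (hpos x) h0), div_le_iff₀ h0]
      linarith
  simpa using h.inv₀ hu.ne'

theorem tendsto_div_atBot (hu : u ∈ Icc (9 / 20 : ℝ) (3 / 5)) (hroot : u ^ 3 + α * u + 1 = 0)
    (hy : ∀ x, HasDerivAt y (slopeField α x (y x)) x ∧ GraphBounds x (y x)) :
    Tendsto (fun x => x / y x) atBot (𝓝 (-(1 / u))) := by
  have hu0 : 0 < u := by linarith [hu.1]
  have hpos : ∀ x, 0 < y x := fun x => by linarith [(hy x).2.lower, abs_nonneg x]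
  have h : Tendsto (fun s => y (-s) / s) atTop (𝓝 u) := by
    have hub : ∀ s, 10 ≤ s → y (-s) / s ≤ 17 / 20 := fun s hs => by
      have := (hy (-s)).2.left_sector (by linarith)
      rw [div_le_iff₀ (by linarith)]
      linarith
    refine tendsto_of_repelling (s₀ := 10) (C := 17 / 20) (δ := 1 / 2) (by norm_num)
      (g := fun s => 1 / (u * (y (-s) / s)) - u - y (-s) / s) (fun s hs => ?_) (fun s hs => ?_)
      fun s hs => ?_
    · have h0 : s ≠ 0 := by linarith
      refine (((hy (-s)).1.scomp s (hasDerivAt_neg s)).div (hasDerivAt_id s) h0).congr_deriv ?_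
      have hα : α = -(1 / u) - u ^ 2 := by field_simp; linarith
      have := (hpos (-s)).ne'
      simp only [slopeField, id, hα, smul_eq_mul, Function.comp_apply]
      field_simp
      ring
    · have h0 : 0 < s := by linarith
      have hq : 0 < y (-s) / s := div_pos (hpos _) h0
      have h1 := hub s hs
      have h2 : 1 / (51 / 100) ≤ 1 / (u * (y (-s) / s)) := by
        have := hu.2
        refine one_div_le_one_div_of_le (by positivity) ?_
        nlinarith
      have := hu.2
      rw [show (1 : ℝ) / (51 / 100) = 100 / 51 by norm_num] at h2
      linarith
    · have h0 : 0 < s := by linarith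
      rw [abs_of_pos (div_pos (hpos _) h0)]
      exact hub s hs
  have h' := ((h.comp tendsto_neg_atBot_atTop).inv₀ hu0.ne').neg
  rw [one_div]
  refine h'.congr fun x => ?_
  simp [div_neg, inv_neg]

end Asymptotics

theorem fcubic_sub (w v α : ℝ) :
    fcubic w α - fcubic v α = (w - v) * (w ^ 2 + w * v + v ^ 2 - α * (w + v)) := by
  unfold fcubic; ring

theorem le_of_fcubic_eq_zero {v w α : ℝ} (hα : -19 / 8 ≤ α) (hv : v ≤ -5 / 3)
    (hv0 : fcubic v α = 0) (hw : fcubic w α = 0) : v ≤ w := by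
  by_contra! hlt
  have h := fcubic_sub w v α
  rw [hv0, hw, sub_zero, eq_comm, mul_eq_zero] at h
  rcases h with h | h
  · linarith
  · nlinarith [sq_nonneg (w - v), mul_pos (a := -(w + v)) (b := -(3 / 4 * (w + v) - α))
      (by linarith) (by linarith)]

theorem ge_of_fcubic_eq_zero {v w α : ℝ} (hα : α ≤ 0) (hv : 0 < v)
    (hv0 : fcubic v α = 0) (hw : fcubic w α = 0) : w ≤ v := by
  by_contra! hlt
  have h := fcubic_sub w v α
  rw [hv0, hw, sub_zero, eq_comm, mul_eq_zero] at h
  have hw0 : 0 < w := hv.trans hlt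
  rcases h with h | h
  · linarith
  · nlinarith [mul_pos hw0 hv, mul_nonneg (neg_nonneg.2 hα) (add_pos hw0 hv).le, pow_pos hv 2]

theorem exists_hasHeteroclinic : ∃ α ∈ Icc (-19 / 8 : ℝ) (-529 / 250), HasHeteroclinic α := by
  obtain ⟨α, hα, y, hy⟩ := exists_global_graph
  have hα1 := hα.1
  have hα2 := hα.2
  obtain ⟨p, hp, hp0⟩ := intermediate_value_Icc (a := 0) (b := 2) (by norm_num)
    (f := fun u : ℝ => u ^ 3 + α * u - 1) (by fun_prop)
    (show (0 : ℝ) ∈ _ from ⟨by norm_num, by norm_num; linarith⟩)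
  obtain ⟨q, hq, hq0⟩ := intermediate_value_Icc' (a := 9 / 20) (b := 3 / 5) (by norm_num)
    (f := fun u : ℝ => u ^ 3 + α * u + 1) (by fun_prop)
    (show (0 : ℝ) ∈ _ from ⟨by norm_num; linarith, by norm_num; linarith⟩)
  simp only at hp0 hq0
  have hppos : 0 < p := by
    rcases hp.1.lt_or_eq with h | h
    · exact h
    · rw [← h] at hp0; norm_num at hp0
  have hqpos : 0 < q := by linarith [hq.1]
  have hv1 : fcubic (-(1 / q)) α = 0 := by
    unfold fcubic; field_simp; linarith
  have hv3 : fcubic (1 / p) α = 0 := by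
    unfold fcubic; field_simp; linarith
  have hq53 : 5 / 3 ≤ 1 / q := by
    rw [le_div_iff₀ hqpos]; linarith [hq.2]
  obtain ⟨v, z, hvz, hbot, htop⟩ := exists_solution_of_graph (m := 1 / 20) (by norm_num)
    (fun x => by linarith [(hy x).2.lower, abs_nonneg x]) (fun x => (hy x).1)
    (tendsto_div_atBot hq hq0 hy) (tendsto_div_atTop hppos hp0 hy)
  exact ⟨α, hα, v, z, -(1 / q), 1 / p,
    ⟨hv1, fun w hw => le_of_fcubic_eq_zero hα1 (by linarith) hv1 hw⟩,
    ⟨hv3, fun w hw => ge_of_fcubic_eq_zero (by linarith) (by positivity) hv3 hw⟩, hvz, hbot, htop⟩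

theorem neg_three_div_cbrt_two_lt : -3 / (2 : ℝ) ^ ((1 : ℝ) / 3) < -19 / 8 := by
  have h : (2 : ℝ) ^ ((1 : ℝ) / 3) < 24 / 19 := by
    refine lt_of_pow_lt_pow_left₀ 3 (by norm_num) ?_
    rw [← Real.rpow_natCast, ← Real.rpow_mul (by norm_num)]
    norm_num
  have h0 : (0 : ℝ) < 2 ^ ((1 : ℝ) / 3) := by positivity
  rw [div_lt_iff₀ h0]
  linarith

theorem le_neg_three_mul_cbrt :
    (-529 / 250 : ℝ) ≤ -3 * ((6 * Real.sqrt 3 - 9) / 4) ^ ((1 : ℝ) / 3) := by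
  have hs : √3 ≤ 17321 / 10000 := Real.sqrt_le_iff.2 ⟨by norm_num, by norm_num⟩
  have hs' : 3 / 2 ≤ √3 := Real.le_sqrt_of_sq_le (by norm_num)
  have h : ((6 * √3 - 9) / 4) ^ ((1 : ℝ) / 3) ≤ 529 / 750 := by
    refine le_of_pow_le_pow_left₀ (n := 3) (by norm_num) (by norm_num) ?_
    rw [← Real.rpow_natCast, ← Real.rpow_mul (by linarith)]
    norm_num
    linarith
  linarith

theorem lt_neg_three_mul_rpow : (-529 / 250 : ℝ) < -3 * (4 : ℝ) ^ (-(1 : ℝ) / 3) := by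
  have h : (4 : ℝ) ^ (-(1 : ℝ) / 3) < 529 / 750 := by
    refine lt_of_pow_lt_pow_left₀ 3 (by norm_num) ?_
    rw [← Real.rpow_natCast, ← Real.rpow_mul (by norm_num)]
    norm_num
  linarith

end Auxiliary

/-- There is a unique `α* ∈ (-∞, -3·4^(-1/3))` for which the transformed system has a
heteroclinic separatrix in the upper half plane; moreover
`-3/2^(1/3) < α* ≤ -3((6√3-9)/4)^(1/3)`. -/
theorem exists_unique_heteroclinic_alpha :
    ∃ αs : ℝ, (αs < -3 * (4 : ℝ) ^ (-(1 : ℝ) / 3) ∧ HasHeteroclinic αs) ∧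
      (∀ β : ℝ, β < -3 * (4 : ℝ) ^ (-(1 : ℝ) / 3) → HasHeteroclinic β → β = αs) ∧
      -3 / (2 : ℝ) ^ ((1 : ℝ) / 3) < αs ∧
      αs ≤ -3 * ((6 * Real.sqrt 3 - 9) / 4) ^ ((1 : ℝ) / 3) := by
  obtain ⟨α, hα, h⟩ := exists_hasHeteroclinic
  have hlt : α < -3 * (4 : ℝ) ^ (-(1 : ℝ) / 3) := hα.2.trans_lt lt_neg_three_mul_rpow
  refine ⟨α, ⟨hlt, h⟩, fun β hβ h' => ?_, neg_three_div_cbrt_two_lt.trans_le hα.1,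
    hα.2.trans le_neg_three_mul_cbrt⟩
  exact le_antisymm
    (not_lt.1 (heteroclinic_not_lt (cube_threshold hlt) (cube_threshold hβ) h h'))
    (not_lt.1 (heteroclinic_not_lt (cube_threshold hβ) (cube_threshold hlt) h' h))
end
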